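/- arXiv:2408.03976 — 5 statements merged into one kernel-verified Lean document; each statement's English description precedes it below -/
import Mathlib

section
/- Let G be a finite connected graph of diameter d and let k be an integer with 1 ≤ k ≤ d. Then for every induced subgraph H of G that is isometric (distances in H equal distances in G) and has diameter k, one has μ_k(G) ≥ μ(H). Consequently μ_k(G) ≥ max{μ(H) : H an induced isometric subgraph of G of diameter k}. -/
open SimpleGraph

/-- Two vertices `x, y` are `S_k`-visible in `G`: there is a shortest `x,y`-path of length
at most `k` none of whose internal vertices lies in `S`. -/
def SKVisible {V : Type*} (G : SimpleGraph V) (S : Set V) (k : ℕ) (x y : V) : Prop :=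
  ∃ p : G.Walk x y, p.IsPath ∧ p.length = G.dist x y ∧ p.length ≤ k ∧
    ∀ v ∈ p.support, v ∈ S → v = x ∨ v = y

/-- `S` is a `k`-distance mutual-visibility set of `G`. -/
def IsKDistMutualVisSet {V : Type*} (G : SimpleGraph V) (k : ℕ) (S : Set V) : Prop :=
  ∀ ⦃x⦄, x ∈ S → ∀ ⦃y⦄, y ∈ S → SKVisible G S k x y

/-- The `k`-distance mutual-visibility number `μ_k(G)`. -/
noncomputable def kdistMu {V : Type*} (G : SimpleGraph V) (k : ℕ) : ℕ :=
  sSup {n | ∃ S : Finset V, IsKDistMutualVisSet G k ↑S ∧ S.card = n}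

/-- Two vertices `x, y` are `S`-visible in `G`. -/
def SVisible {V : Type*} (G : SimpleGraph V) (S : Set V) (x y : V) : Prop :=
  ∃ p : G.Walk x y, p.IsPath ∧ p.length = G.dist x y ∧
    ∀ v ∈ p.support, v ∈ S → v = x ∨ v = y

/-- `S` is a mutual-visibility set of `G`. -/
def IsMutualVisSet {V : Type*} (G : SimpleGraph V) (S : Set V) : Prop :=
  ∀ ⦃x⦄, x ∈ S → ∀ ⦃y⦄, y ∈ S → SVisible G S x y

/-- The mutual-visibility number `μ(G)`. -/
noncomputable def mutualVisNum {V : Type*} (G : SimpleGraph V) : ℕ :=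
  sSup {n | ∃ S : Finset V, IsMutualVisSet G ↑S ∧ S.card = n}

lemma SVisible.map_skVisible {V W : Type*} {H : SimpleGraph W} {G : SimpleGraph V}
    (f : H ↪g G) (hf : ∀ u v, H.dist u v = G.dist (f u) (f v)) {S : Set W} {k : ℕ} {x y : W}
    (hk : H.dist x y ≤ k) (h : SVisible H S x y) : SKVisible G (f '' S) k (f x) (f y) := by
  obtain ⟨p, hp, hlen, hS⟩ := h
  refine ⟨p.map f.toHom, hp.map f.injective, ?_, ?_, ?_⟩
  · rw [Walk.length_map, hlen, hf]
  · rwa [Walk.length_map, hlen]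
  · intro v hv hvS
    rw [Walk.support_map, List.mem_map] at hv
    obtain ⟨w, hw, rfl⟩ := hv
    obtain ⟨w', hw', hww'⟩ := hvS
    obtain rfl := f.injective hww'
    exact (hS w' hw hw').imp (congrArg f) (congrArg f)

lemma IsMutualVisSet.image {V W : Type*} {H : SimpleGraph W} {G : SimpleGraph V}
    (f : H ↪g G) (hf : ∀ u v, H.dist u v = G.dist (f u) (f v)) {S : Set W} {k : ℕ}
    (hk : ∀ u v, H.dist u v ≤ k) (h : IsMutualVisSet H S) :
    IsKDistMutualVisSet G k (f '' S) := by
  rintro _ ⟨x, hx, rfl⟩ _ ⟨y, hy, rfl⟩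
  exact (h hx hy).map_skVisible f hf (hk x y)

lemma IsKDistMutualVisSet.card_le_kdistMu {V : Type*} [Fintype V] {G : SimpleGraph V} {k : ℕ}
    {S : Finset V} (h : IsKDistMutualVisSet G k ↑S) : S.card ≤ kdistMu G k := by
  refine le_csSup ⟨Fintype.card V, ?_⟩ ⟨S, h, rfl⟩
  rintro _ ⟨T, -, rfl⟩
  exact T.card_le_univ

lemma mutualVisNum_le_kdistMu {V W : Type*} [Fintype V] {H : SimpleGraph W} {G : SimpleGraph V}
    (f : H ↪g G) (hf : ∀ u v, H.dist u v = G.dist (f u) (f v)) {k : ℕ}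
    (hk : ∀ u v, H.dist u v ≤ k) : mutualVisNum H ≤ kdistMu G k := by
  refine csSup_le' ?_
  rintro _ ⟨S, hS, rfl⟩
  rw [← S.card_map f.toEmbedding]
  refine IsKDistMutualVisSet.card_le_kdistMu ?_
  rw [Finset.coe_map]
  exact hS.image f hf hk

/-- For a finite connected graph `G` of diameter `d` and `1 ≤ k ≤ d`:
for every induced isometric subgraph `H` of diameter `k`, `μ_k(G) ≥ μ(H)`; consequently
`μ_k(G) ≥ max { μ(H) : H induced isometric subgraph of G of diameter k }`. -/
theorem stmt1 {V : Type*} [Fintype V] (G : SimpleGraph V) (hG : G.Connected)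
    (d k : ℕ) (hd : G.diam = d) (hk1 : 1 ≤ k) (hkd : k ≤ d) :
    (∀ A : Set V,
      (∀ u v : A, (G.induce A).dist u v = G.dist u v) →
      (G.induce A).diam = k →
      mutualVisNum (G.induce A) ≤ kdistMu G k) ∧
    sSup {n | ∃ A : Set V,
        (∀ u v : A, (G.induce A).dist u v = G.dist u v) ∧
        (G.induce A).diam = k ∧ mutualVisNum (G.induce A) = n} ≤ kdistMu G k := by
  have key : ∀ A : Set V, (∀ u v : A, (G.induce A).dist u v = G.dist u v) →
      (G.induce A).diam = k → mutualVisNum (G.induce A) ≤ kdistMu G k := by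
    intro A hA hdiam
    have hfin : (G.induce A).ediam ≠ ⊤ := ediam_ne_top_of_diam_ne_zero (by omega)
    exact mutualVisNum_le_kdistMu (Embedding.induce A) hA
      fun u v ↦ (dist_le_diam hfin).trans_eq hdiam
  refine ⟨key, csSup_le' ?_⟩
  rintro _ ⟨A, hA, hdiam, rfl⟩
  exact key A hA hdiam
end

section
/- For any integer r ≥ 3 and any integer k with 2 ≤ k ≤ r−1, the k-distance mutual-visibility number of the strong product of the path P_r with the path P_2 satisfies μ_k(P_r ⊠ P_2) = k + 3. -/
open SimpleGraph

/-- The strong product of two simple graphs. -/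
def strongProd {α β : Type*} (G : SimpleGraph α) (H : SimpleGraph β) :
    SimpleGraph (α × β) :=
  SimpleGraph.fromRel (fun x y =>
    (x.1 = y.1 ∧ H.Adj x.2 y.2) ∨ (x.2 = y.2 ∧ G.Adj x.1 y.1) ∨
    (G.Adj x.1 y.1 ∧ H.Adj x.2 y.2))

/-- Distinct vertices of `P_r ⊠ P_2` are adjacent iff their columns differ by at most one. -/
lemma strongProd_path_two_adj {r : ℕ} {x y : Fin r × Fin 2} :
    (strongProd (pathGraph r) (pathGraph 2)).Adj x y ↔
      x ≠ y ∧ x.1.val ≤ y.1.val + 1 ∧ y.1.val ≤ x.1.val + 1 := by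
  obtain ⟨a, b⟩ := x
  obtain ⟨c, d⟩ := y
  simp only [strongProd, fromRel_adj, pathGraph_adj, ne_eq, Prod.mk.injEq, Fin.ext_iff]
  omega

lemma col_le_add_length {r : ℕ} {x y : Fin r × Fin 2}
    (p : (strongProd (pathGraph r) (pathGraph 2)).Walk x y) :
    y.1.val ≤ x.1.val + p.length := by
  induction p with
  | nil => simp
  | cons h p ih =>
    have := strongProd_path_two_adj.1 h
    rw [Walk.length_cons]
    omega

/-- A walk meets every column between the columns of its ends. -/
lemma exists_mem_support_col_eq {r : ℕ} {x y : Fin r × Fin 2}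
    (p : (strongProd (pathGraph r) (pathGraph 2)).Walk x y) {c : Fin r}
    (hx : x.1 ≤ c) (hy : c ≤ y.1) : ∃ v ∈ p.support, v.1 = c := by
  induction p with
  | nil => exact ⟨_, by simp, le_antisymm hx hy⟩
  | @cons u v w h p ih =>
    by_cases huc : u.1 = c
    · exact ⟨u, by simp, huc⟩
    · have hadj := strongProd_path_two_adj.1 h
      have hv : v.1 ≤ c := by
        rw [Fin.le_def] at *
        rw [Fin.ext_iff] at huc
        omega
      obtain ⟨z, hz, hzc⟩ := ih hv hy
      exact ⟨z, by simp [hz], hzc⟩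

/-- Vertices in different columns are joined by a monotone walk whose internal vertices lie in
the second row, strictly between the columns of the ends. -/
lemma exists_walk_second_row {r : ℕ} (n : ℕ) {x y : Fin r × Fin 2}
    (hxy : y.1.val = x.1.val + n + 1) :
    ∃ p : (strongProd (pathGraph r) (pathGraph 2)).Walk x y, p.length = n + 1 ∧
      ∀ v ∈ p.support, v = x ∨ v = y ∨
        (v.2 = 1 ∧ x.1.val < v.1.val ∧ v.1.val < y.1.val) := by
  induction n generalizing x with
  | zero =>
    have h : (strongProd (pathGraph r) (pathGraph 2)).Adj x y := by
      rw [strongProd_path_two_adj]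
      refine ⟨?_, by omega, by omega⟩
      rintro rfl
      omega
    refine ⟨h.toWalk, by simp, ?_⟩
    intro v hv
    simp at hv
    tauto
  | succ n ih =>
    let z : Fin r × Fin 2 := (⟨x.1.val + 1, by omega⟩, 1)
    have hz : z.1.val = x.1.val + 1 := rfl
    have h : (strongProd (pathGraph r) (pathGraph 2)).Adj x z := by
      rw [strongProd_path_two_adj]
      refine ⟨fun hxz => ?_, by omega, by omega⟩
      rw [← hxz] at hz
      omega
    obtain ⟨p, hp, hs⟩ := ih (x := z) (by omega)
    refine ⟨.cons h p, by simp [hp], ?_⟩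
    intro v hv
    rw [Walk.support_cons, List.mem_cons] at hv
    rcases hv with hv | hv
    · exact .inl hv
    · rcases hs v hv with rfl | hv | ⟨h1, h2, h3⟩
      · exact .inr (.inr ⟨rfl, by omega, by omega⟩)
      · exact .inr (.inl hv)
      · exact .inr (.inr ⟨h1, by omega, h3⟩)

lemma SKVisible.symm {V : Type*} {G : SimpleGraph V} {S : Set V} {k : ℕ} {x y : V}
    (h : SKVisible G S k x y) : SKVisible G S k y x := by
  obtain ⟨p, hp, hd, hk, hs⟩ := h
  refine ⟨p.reverse, hp.reverse, by rw [Walk.length_reverse, hd, dist_comm], by simpa, ?_⟩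
  intro v hv hvS
  exact (hs v (by simpa using hv) hvS).symm

lemma SKVisible.refl {V : Type*} (G : SimpleGraph V) (S : Set V) (k : ℕ) (x : V) :
    SKVisible G S k x x :=
  ⟨.nil, by simp, by simp, by simp, by simp⟩

lemma SKVisible.of_adj {V : Type*} {G : SimpleGraph V} {S : Set V} {k : ℕ} {x y : V}
    (hk : 1 ≤ k) (h : G.Adj x y) : SKVisible G S k x y := by
  have hd : h.toWalk.length = G.dist x y := by simp [dist_eq_one_iff_adj.2 h]
  exact ⟨h.toWalk, h.toWalk.isPath_of_length_eq_dist hd, hd, by simpa, by simp⟩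

lemma skVisible_of_col_lt {r k : ℕ} {S : Set (Fin r × Fin 2)} {x y : Fin r × Fin 2}
    (hlt : x.1.val < y.1.val) (hle : y.1.val ≤ x.1.val + k)
    (hS : ∀ v ∈ S, v.2 = 1 → v.1.val ≤ x.1.val ∨ y.1.val ≤ v.1.val) :
    SKVisible (strongProd (pathGraph r) (pathGraph 2)) S k x y := by
  obtain ⟨n, hn⟩ := Nat.exists_eq_add_of_lt hlt
  obtain ⟨p, hp, hs⟩ := exists_walk_second_row n hn
  obtain ⟨q, hq⟩ := p.reachable.exists_walk_length_eq_dist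
  have hd : p.length = (strongProd (pathGraph r) (pathGraph 2)).dist x y := by
    refine le_antisymm ?_ (dist_le p)
    have := col_le_add_length q
    omega
  refine ⟨p, p.isPath_of_length_eq_dist hd, hd, by omega, fun v hv hvS => ?_⟩
  rcases hs v hv with h | h | ⟨h1, h2, h3⟩
  · exact .inl h
  · exact .inr h
  · have := hS v hvS h1
    omega

lemma SKVisible.col_le {r k : ℕ} {S : Set (Fin r × Fin 2)} {x y : Fin r × Fin 2}
    (h : SKVisible (strongProd (pathGraph r) (pathGraph 2)) S k x y) :
    y.1.val ≤ x.1.val + k := by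
  obtain ⟨p, -, -, hk, -⟩ := h
  have := col_le_add_length p
  omega

/-- A full column strictly between two vertices blocks their visibility. -/
lemma not_skVisible_of_full_col {r k : ℕ} {S : Set (Fin r × Fin 2)} {x y : Fin r × Fin 2}
    {c : Fin r} (hx : x.1 < c) (hy : c < y.1) (hc : ∀ i, (c, i) ∈ S) :
    ¬ SKVisible (strongProd (pathGraph r) (pathGraph 2)) S k x y := by
  rintro ⟨p, -, -, -, hs⟩
  obtain ⟨⟨d, i⟩, hv, rfl⟩ := exists_mem_support_col_eq p hx.le hy.le
  rcases hs _ hv (hc i) with rfl | rfl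
  · exact hx.false
  · exact hy.false

lemma card_le_of_isKDistMutualVisSet {r k : ℕ} {S : Finset (Fin r × Fin 2)}
    (hS : IsKDistMutualVisSet (strongProd (pathGraph r) (pathGraph 2)) k
      (S : Set (Fin r × Fin 2))) :
    S.card ≤ k + 3 := by
  classical
  let A : Fin 2 → Finset (Fin r) := fun i => Finset.univ.filter fun c => (c, i) ∈ S
  have hA : ∀ i c, c ∈ A i ↔ (c, i) ∈ S := by simp [A]
  have hcard : S.card = (A 0).card + (A 1).card := by
    have hSA : S = A 0 ×ˢ {0} ∪ A 1 ×ˢ {1} := by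
      ext ⟨c, i⟩
      fin_cases i <;> simp [hA]
    conv_lhs => rw [hSA]
    rw [Finset.card_union_of_disjoint, Finset.card_product, Finset.card_product]
    · simp
    · rw [Finset.disjoint_left]
      rintro ⟨c, i⟩
      fin_cases i <;> simp
  have hunion : (A 0 ∪ A 1).card ≤ k + 1 := by
    have hmem : ∀ c ∈ A 0 ∪ A 1, ∃ i, (c, i) ∈ S := by
      intro c hc
      simp only [Finset.mem_union, hA] at hc
      exact hc.elim (⟨0, ·⟩) (⟨1, ·⟩)
    rcases (A 0 ∪ A 1).eq_empty_or_nonempty with h | h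
    · simp [h]
    · have hsub : (A 0 ∪ A 1).map Fin.valEmbedding ⊆
          Finset.Icc ((A 0 ∪ A 1).min' h).val (((A 0 ∪ A 1).min' h).val + k) := by
        intro n hn
        obtain ⟨c, hc, rfl⟩ := Finset.mem_map.1 hn
        obtain ⟨i, hi⟩ := hmem c hc
        obtain ⟨j, hj⟩ := hmem _ (Finset.min'_mem _ h)
        exact Finset.mem_Icc.2 ⟨Finset.min'_le _ _ hc, (hS hj hi).col_le⟩
      have := Finset.card_le_card hsub
      rw [Finset.card_map, Nat.card_Icc] at this
      omega
  have hinter : (A 0 ∩ A 1).card ≤ 2 := by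
    have hfull : ∀ c ∈ A 0 ∩ A 1, ∀ i, (c, i) ∈ S := by
      intro c hc
      simpa only [Fin.forall_fin_two, Finset.mem_inter, hA] using hc
    rcases (A 0 ∩ A 1).eq_empty_or_nonempty with h | h
    · simp [h]
    · have hsub : A 0 ∩ A 1 ⊆ {(A 0 ∩ A 1).min' h, (A 0 ∩ A 1).max' h} := by
        intro c hc
        rw [Finset.mem_insert, Finset.mem_singleton]
        by_contra! hne
        exact not_skVisible_of_full_col (lt_of_le_of_ne (Finset.min'_le _ _ hc) hne.1.symm)
          (lt_of_le_of_ne (Finset.le_max' _ _ hc) hne.2) (hfull c hc)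
          (hS (hfull _ (Finset.min'_mem _ h) 0) (hfull _ (Finset.max'_mem _ h) 0))
      exact (Finset.card_le_card hsub).trans Finset.card_le_two
  have := Finset.card_union_add_card_inter (A 0) (A 1)
  omega

lemma exists_isKDistMutualVisSet_card {r k : ℕ} (hk : 1 ≤ k) (hkr : k < r) :
    ∃ S : Finset (Fin r × Fin 2), IsKDistMutualVisSet
      (strongProd (pathGraph r) (pathGraph 2)) k (S : Set (Fin r × Fin 2)) ∧
      S.card = k + 3 := by
  classical
  let a : Fin r := ⟨0, by omega⟩
  let b : Fin r := ⟨k, hkr⟩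
  let S : Finset (Fin r × Fin 2) := Finset.Iic b ×ˢ {0} ∪ {a, b} ×ˢ {1}
  have hcol : ∀ v ∈ S, v.1.val ≤ k := by
    rintro ⟨c, i⟩ hv
    change c.val ≤ k
    simp only [S, Finset.mem_union, Finset.mem_product, Finset.mem_Iic, Finset.mem_insert,
      Finset.mem_singleton, a, b, Fin.le_def, Fin.ext_iff] at hv
    omega
  have hrow : ∀ v ∈ S, v.2 = 1 → v.1.val = 0 ∨ v.1.val = k := by
    rintro ⟨c, i⟩ hv hi
    change c.val = 0 ∨ c.val = k
    simp only [S, Finset.mem_union, Finset.mem_product, Finset.mem_Iic, Finset.mem_insert,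
      Finset.mem_singleton, a, b, Fin.le_def, Fin.ext_iff] at hv hi
    omega
  have key : ∀ x ∈ S, ∀ y ∈ S, x.1.val < y.1.val →
      SKVisible (strongProd (pathGraph r) (pathGraph 2)) (S : Set (Fin r × Fin 2)) k x y := by
    intro x hx y hy hxy
    have := hcol y hy
    refine skVisible_of_col_lt hxy (by omega) fun v hv hv1 => ?_
    have := hrow v hv hv1
    omega
  refine ⟨S, fun x hx y hy => ?_, ?_⟩
  · rcases lt_trichotomy x.1.val y.1.val with h | h | h
    · exact key x hx y hy h
    · by_cases hxy : x = y
      · exact hxy ▸ .refl _ _ _ _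
      · exact .of_adj hk (strongProd_path_two_adj.2 ⟨hxy, by omega, by omega⟩)
    · exact (key y hy x hx h).symm
  · have hab : a ≠ b := by
      simp only [a, b, ne_eq, Fin.ext_iff]
      omega
    rw [Finset.card_union_of_disjoint, Finset.card_product, Finset.card_product,
      Finset.card_pair hab, Fin.card_Iic]
    · simp [b]
    · rw [Finset.disjoint_left]
      rintro ⟨c, i⟩
      fin_cases i <;> simp

/-- For `r ≥ 3` and `2 ≤ k ≤ r - 1`, `μ_k(P_r ⊠ P_2) = k + 3`. -/
theorem stmt2 (r k : ℕ) (hr : 3 ≤ r) (hk2 : 2 ≤ k) (hkr : k ≤ r - 1) :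
    kdistMu (strongProd (SimpleGraph.pathGraph r) (SimpleGraph.pathGraph 2)) k = k + 3 := by
  refine IsGreatest.csSup_eq ⟨exists_isKDistMutualVisSet_card (by omega) (by omega), ?_⟩
  rintro n ⟨S, hS, rfl⟩
  exact card_le_of_isKDistMutualVisSet hS
end

section
/- Let T be a caterpillar tree whose set B(T) of non-leaf vertices induces a path on r = diam(T) − 1 ≥ 3 vertices, and suppose every vertex of B(T) has degree exactly q ≥ 2 in T. Then for every integer k with 2 ≤ k ≤ diam(T) = r + 1, μ_k(T) = k(q−2) − q + 4. -/
open SimpleGraph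

namespace SimpleGraph

variable {V : Type*}

/-- In a tree, every path is a geodesic. -/
theorem IsTree.length_eq_dist_of_isPath {T : SimpleGraph V} (hT : T.IsTree) {x y : V}
    {p : T.Walk x y} (hp : p.IsPath) : p.length = T.dist x y := by
  obtain ⟨w, hw, hl⟩ := hT.connected.exists_path_of_dist x y
  have := (hT.isAcyclic.subsingleton_path x y).elim ⟨p, hp⟩ ⟨w, hw⟩
  rw [← hl, show p = w from congrArg Subtype.val this]

/-- Visibility in a tree, expressed through distances only. -/
theorem IsTree.sKVisible_iff {T : SimpleGraph V} (hT : T.IsTree) {S : Set V} {k : ℕ} {x y : V} :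
    SKVisible T S k x y ↔ T.dist x y ≤ k ∧
      ∀ z ∈ S, T.dist x z + T.dist z y = T.dist x y → z = x ∨ z = y := by
  classical
  constructor
  · rintro ⟨p, hp, hl, hk, h⟩
    refine ⟨hl ▸ hk, fun z hz hd => h z ?_ hz⟩
    obtain ⟨w₁, h₁⟩ := hT.connected.exists_walk_length_eq_dist x z
    obtain ⟨w₂, h₂⟩ := hT.connected.exists_walk_length_eq_dist z y
    have hw : (w₁.append w₂).IsPath :=
      Walk.isPath_of_length_eq_dist _ (by rw [Walk.length_append, h₁, h₂, hd])
    have := congrArg Subtype.val ((hT.isAcyclic.subsingleton_path x y).elim ⟨p, hp⟩ ⟨_, hw⟩)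
    simp only at this
    rw [this, Walk.mem_support_append_iff]
    exact Or.inl w₁.end_mem_support
  · rintro ⟨hk, h⟩
    obtain ⟨p, hp, hl⟩ := hT.connected.exists_path_of_dist x y
    refine ⟨p, hp, hl, hl ▸ hk, fun z hz hS => h z hS ?_⟩
    have h₁ := dist_le (p.takeUntil z hz)
    have h₂ := dist_le (p.dropUntil z hz)
    have h₃ := congrArg Walk.length (p.take_spec hz)
    rw [Walk.length_append] at h₃
    have := hT.connected.dist_triangle (u := x) (v := z) (w := y)
    omega

/-- A vertex with a single neighbour `u` is one step further than `u` from every other vertex. -/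
theorem Connected.dist_eq_succ_of_unique_adj {G : SimpleGraph V} (hG : G.Connected) {x u y : V}
    (hxu : G.Adj x u) (hu : ∀ w, G.Adj x w → w = u) (hxy : x ≠ y) :
    G.dist x y = G.dist u y + 1 := by
  obtain ⟨p, hp⟩ := hG.exists_walk_length_eq_dist x y
  have h₁ := hG.dist_triangle (u := x) (v := u) (w := y)
  rw [dist_eq_one_iff_adj.2 hxu] at h₁
  cases p with
  | nil => exact absurd rfl hxy
  | cons h p =>
    obtain rfl := hu _ h
    have := dist_le p
    rw [Walk.length_cons] at hp
    omega

/-- In a connected graph having a vertex of degree greater than one, every vertex of smaller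
degree has exactly one neighbour, and that neighbour has degree greater than one. -/
theorem Connected.exists_unique_adj_of_degree_le_one [Fintype V] {G : SimpleGraph V}
    [DecidableRel G.Adj] (hG : G.Connected) {x b : V} (hb : 1 < G.degree b)
    (hx : ¬ 1 < G.degree x) :
    ∃ u, 1 < G.degree u ∧ G.Adj x u ∧ ∀ w, G.Adj x w → w = u := by
  obtain ⟨p, hp, -⟩ := hG.exists_path_of_dist x b
  cases p with
  | nil => exact absurd hb hx
  | @cons _ u _ h p =>
    refine ⟨u, ?_, h, fun w hw => ?_⟩
    · cases p with
      | nil => exact hb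
      | @cons _ w _ h' p =>
        rw [← G.card_neighborFinset_eq_degree, Finset.one_lt_card]
        refine ⟨x, by simpa using h.symm, w, by simpa using h', ?_⟩
        rintro rfl
        simp at hp
    · by_contra hne
      apply hx
      rw [← G.card_neighborFinset_eq_degree, Finset.one_lt_card]
      exact ⟨w, by simpa using hw, u, by simpa using h, hne⟩

/-- Coordinates on a caterpillar: the spine is `v 0, …, v (r - 1)`, every vertex `x` has a
position `pos x` along the spine, and `ht x` is `0` on the spine and `1` on the leaves. -/
structure CaterpillarCoord (T : SimpleGraph V) (r : ℕ) (v : ℕ → V) (pos ht : V → ℕ) : Prop where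
  pos_lt : ∀ x, pos x < r
  ht_le : ∀ x, ht x ≤ 1
  pos_v : ∀ i < r, pos (v i) = i
  ht_v : ∀ i < r, ht (v i) = 0
  v_pos : ∀ x, ht x = 0 → v (pos x) = x
  adj_v : ∀ i < r, ∀ j < r, T.Adj (v i) (v j) ↔ i + 1 = j ∨ j + 1 = i
  adj_leaf : ∀ x, ht x = 1 → ∀ u, T.Adj x u ↔ u = v (pos x)

theorem exists_caterpillarCoord [Fintype V] {T : SimpleGraph V} [DecidableRel T.Adj]
    (hT : T.Connected) {r : ℕ} (hr : 0 < r)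
    (φ : T.induce {v : V | 1 < T.degree v} ≃g pathGraph r) :
    ∃ v pos ht, CaterpillarCoord T r v pos ht ∧ ∀ x, ht x = 0 ↔ 1 < T.degree x := by
  classical
  let v : ℕ → V := fun i => if h : i < r then (φ.symm ⟨i, h⟩).1 else (φ.symm ⟨0, hr⟩).1
  have hv : ∀ i (h : i < r), v i = (φ.symm ⟨i, h⟩).1 := fun i h => dif_pos h
  have hvB : ∀ i < r, 1 < T.degree (v i) := fun i h => by
    rw [hv i h]; exact (φ.symm ⟨i, h⟩).2
  have hinj : ∀ i < r, ∀ j < r, v i = v j → i = j := fun i hi j hj h => by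
    rw [hv i hi, hv j hj] at h
    simpa using φ.symm.injective (Subtype.ext h)
  have hsurj : ∀ x, 1 < T.degree x → ∃ i < r, v i = x := fun x hx => by
    refine ⟨φ ⟨x, hx⟩, (φ ⟨x, hx⟩).2, ?_⟩
    rw [hv _ (φ ⟨x, hx⟩).2]
    simp
  have hadj : ∀ i < r, ∀ j < r, T.Adj (v i) (v j) ↔ i + 1 = j ∨ j + 1 = i := fun i hi j hj => by
    have := φ.symm.map_adj_iff (v := ⟨i, hi⟩) (w := ⟨j, hj⟩)
    rw [pathGraph_adj] at this
    rw [hv i hi, hv j hj]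
    exact this
  have hpos : ∀ x, ∃ i < r, (1 < T.degree x → v i = x) ∧
      (¬ 1 < T.degree x → ∀ u, T.Adj x u ↔ u = v i) := fun x => by
    by_cases hx : 1 < T.degree x
    · obtain ⟨i, hi, h⟩ := hsurj x hx
      exact ⟨i, hi, fun _ => h, fun h' => absurd hx h'⟩
    · obtain ⟨u, hu, hxu, h⟩ := hT.exists_unique_adj_of_degree_le_one (hvB 0 hr) hx
      obtain ⟨i, hi, rfl⟩ := hsurj u hu
      exact ⟨i, hi, fun h' => absurd h' hx, fun _ w => ⟨h w, fun e => e ▸ hxu⟩⟩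
  choose pos hlt hsp hlf using hpos
  refine ⟨v, pos, fun x => if 1 < T.degree x then 0 else 1, ⟨hlt, ?_, ?_, ?_, ?_, hadj, ?_⟩, ?_⟩
  · intro x; split_ifs <;> simp
  · intro i hi
    exact hinj _ (hlt _) _ hi (hsp _ (hvB i hi))
  · intro i hi; exact if_pos (hvB i hi)
  · intro x hx; exact hsp x (by by_contra h; simp [h] at hx)
  · intro x hx; exact hlf x (by intro h; simp [h] at hx)
  · intro x; dsimp only; split_ifs with h <;> simp [h]

namespace CaterpillarCoord

variable {T : SimpleGraph V} {r : ℕ} {v : ℕ → V} {pos ht : V → ℕ}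

theorem dist_v_add (hc : CaterpillarCoord T r v pos ht) (hT : T.IsTree) (i n : ℕ)
    (h : i + n < r) : T.dist (v i) (v (i + n)) = n := by
  suffices H : ∃ p : T.Walk (v i) (v (i + n)), p.IsPath ∧ p.length = n ∧
      ∀ x ∈ p.support, pos x ≤ i + n by
    obtain ⟨p, hp, hl, -⟩ := H
    rw [← hT.length_eq_dist_of_isPath hp, hl]
  induction n with
  | zero => exact ⟨.nil, by simp, rfl, by simp [hc.pos_v i h]⟩
  | succ n ih =>
    obtain ⟨p, hp, hl, hs⟩ := ih (by omega)
    have ha : T.Adj (v (i + n)) (v (i + (n + 1))) :=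
      (hc.adj_v _ (by omega) _ h).2 (Or.inl (by omega))
    refine ⟨p.concat ha, hp.concat (fun hm => ?_) ha, by simp [hl], fun x hx => ?_⟩
    · have := hs _ hm
      rw [hc.pos_v _ h] at this
      omega
    · rw [Walk.support_concat, List.mem_append, List.mem_singleton] at hx
      rcases hx with hx | rfl
      · have := hs x hx
        omega
      · rw [hc.pos_v _ h]

theorem dist_v (hc : CaterpillarCoord T r v pos ht) (hT : T.IsTree) {i j : ℕ} (hi : i < r)
    (hj : j < r) : T.dist (v i) (v j) = (i - j) + (j - i) := by
  rcases le_total i j with h | h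
  · obtain ⟨n, rfl⟩ := Nat.exists_eq_add_of_le h
    rw [hc.dist_v_add hT i n hj]; omega
  · obtain ⟨n, rfl⟩ := Nat.exists_eq_add_of_le h
    rw [dist_comm, hc.dist_v_add hT j n hi]; omega

theorem ht_cases (hc : CaterpillarCoord T r v pos ht) (x : V) : ht x = 0 ∨ ht x = 1 := by
  have := hc.ht_le x
  omega

theorem dist_v_right (hc : CaterpillarCoord T r v pos ht) (hT : T.IsTree) (x : V) {j : ℕ}
    (hj : j < r) : T.dist x (v j) = ht x + ((pos x - j) + (j - pos x)) := by
  rcases hc.ht_cases x with h | h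
  · rw [← hc.dist_v hT (hc.pos_lt x) hj, hc.v_pos x h, h, zero_add]
  · rw [hT.connected.dist_eq_succ_of_unique_adj ((hc.adj_leaf x h _).2 rfl)
      (fun w => (hc.adj_leaf x h w).1), hc.dist_v hT (hc.pos_lt x) hj, h, add_comm]
    rintro rfl
    have := hc.ht_v j hj
    omega

theorem dist_eq (hc : CaterpillarCoord T r v pos ht) (hT : T.IsTree) {x y : V} (hxy : x ≠ y) :
    T.dist x y = ht x + ht y + ((pos x - pos y) + (pos y - pos x)) := by
  rcases hc.ht_cases y with h | h
  · have := hc.dist_v_right hT x (hc.pos_lt y)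
    rw [hc.v_pos y h] at this
    omega
  · rw [dist_comm, hT.connected.dist_eq_succ_of_unique_adj ((hc.adj_leaf y h _).2 rfl)
      (fun w => (hc.adj_leaf y h w).1) hxy.symm, dist_comm,
      hc.dist_v_right hT x (hc.pos_lt y), h]
    omega

theorem eq_of_pos_eq (hc : CaterpillarCoord T r v pos ht) {x y : V} (hx : ht x = 0)
    (hy : ht y = 0) (h : pos x = pos y) : x = y := by
  rw [← hc.v_pos x hx, ← hc.v_pos y hy, h]

variable [Fintype V] [DecidableRel T.Adj] {q : ℕ}

theorem card_leaves_add (hc : CaterpillarCoord T r v pos ht) {i : ℕ} (hi : i < r) :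
    (Finset.univ.filter fun x => ht x = 1 ∧ pos x = i).card +
      ((Finset.range r).filter fun j => i + 1 = j ∨ j + 1 = i).card = T.degree (v i) := by
  classical
  have hinj : Set.InjOn v ((Finset.range r).filter fun j => i + 1 = j ∨ j + 1 = i) := by
    intro a ha b hb h
    simp only [Finset.coe_filter, Finset.mem_range, Set.mem_ofPred_eq] at ha hb
    rw [← hc.pos_v a ha.1, ← hc.pos_v b hb.1, h]
  rw [← Finset.card_image_of_injOn hinj, ← Finset.card_union_of_disjoint,
    ← T.card_neighborFinset_eq_degree]
  · congr 1
    ext x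
    simp only [Finset.mem_union, Finset.mem_filter, Finset.mem_univ, true_and, Finset.mem_image,
      Finset.mem_range, mem_neighborFinset]
    constructor
    · rintro (⟨h, rfl⟩ | ⟨j, ⟨hj, h⟩, rfl⟩)
      · exact ((hc.adj_leaf x h _).2 rfl).symm
      · exact (hc.adj_v i hi j hj).2 h
    · intro h
      rcases hc.ht_cases x with h0 | h1
      · refine Or.inr ⟨pos x, ⟨hc.pos_lt x, ?_⟩, hc.v_pos x h0⟩
        rw [← hc.adj_v i hi _ (hc.pos_lt x), hc.v_pos x h0]
        exact h
      · refine Or.inl ⟨h1, ?_⟩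
        rw [← hc.pos_v i hi, (hc.adj_leaf x h1 _).1 h.symm, hc.pos_v _ (hc.pos_lt x)]
  · rw [Finset.disjoint_left]
    intro x hx hx'
    simp only [Finset.mem_filter, Finset.mem_univ, true_and, Finset.mem_image,
      Finset.mem_range] at hx hx'
    obtain ⟨j, ⟨hj, -⟩, rfl⟩ := hx'
    have := hc.ht_v j hj
    omega

theorem card_leaves_at (hc : CaterpillarCoord T r v pos ht) (hr : 3 ≤ r) (hq : 2 ≤ q)
    (hdeg : ∀ i < r, T.degree (v i) = q) {i : ℕ} (hi : i < r) :
    (Finset.univ.filter fun x => ht x = 1 ∧ pos x = i).card =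
      (q - 2) + ((if i = 0 then 1 else 0) + if i = r - 1 then 1 else 0) := by
  have h := hc.card_leaves_add hi
  rw [hdeg i hi] at h
  rcases Nat.eq_zero_or_pos i with rfl | h0
  · have : ((Finset.range r).filter fun j => 0 + 1 = j ∨ j + 1 = 0) = {1} := by
      ext j; simp only [Finset.mem_filter, Finset.mem_range, Finset.mem_singleton]; omega
    rw [this, Finset.card_singleton] at h
    rw [if_pos rfl, if_neg (by omega)]
    omega
  by_cases h1 : i = r - 1
  · have : ((Finset.range r).filter fun j => i + 1 = j ∨ j + 1 = i) = {i - 1} := by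
      ext j; simp only [Finset.mem_filter, Finset.mem_range, Finset.mem_singleton]; omega
    rw [this, Finset.card_singleton] at h
    rw [if_neg (by omega), if_pos h1]
    omega
  · have : ((Finset.range r).filter fun j => i + 1 = j ∨ j + 1 = i) = {i - 1, i + 1} := by
      ext j
      simp only [Finset.mem_filter, Finset.mem_range, Finset.mem_singleton, Finset.mem_insert]
      omega
    rw [this, Finset.card_pair (by omega)] at h
    rw [if_neg (by omega), if_neg h1]
    omega

theorem card_leaves (hc : CaterpillarCoord T r v pos ht) (hr : 3 ≤ r) (hq : 2 ≤ q)
    (hdeg : ∀ i < r, T.degree (v i) = q) {W : Finset ℕ} (hW : ∀ i ∈ W, i < r) :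
    (Finset.univ.filter fun x => ht x = 1 ∧ pos x ∈ W).card =
      W.card * (q - 2) + ((if 0 ∈ W then 1 else 0) + if r - 1 ∈ W then 1 else 0) := by
  rw [Finset.card_eq_sum_card_fiberwise (f := pos) (t := W)
    (by intro x hx; simp only [Finset.coe_filter, Set.mem_ofPred_eq] at hx; exact hx.2.2)]
  have : ∀ i ∈ W, ((Finset.univ.filter fun x => ht x = 1 ∧ pos x ∈ W).filter
      fun x => pos x = i).card =
      (q - 2) + ((if i = 0 then 1 else 0) + if i = r - 1 then 1 else 0) := by
    intro i hi
    rw [← hc.card_leaves_at hr hq hdeg (hW i hi), Finset.filter_filter]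
    congr 1
    ext x
    simp only [Finset.mem_filter, Finset.mem_univ, true_and]
    constructor
    · rintro ⟨⟨h, -⟩, h'⟩; exact ⟨h, h'⟩
    · rintro ⟨h, rfl⟩; exact ⟨⟨h, hi⟩, rfl⟩
  rw [Finset.sum_congr rfl this, Finset.sum_add_distrib, Finset.sum_add_distrib]
  simp

theorem exists_isKDistMutualVisSet (hc : CaterpillarCoord T r v pos ht) (hT : T.IsTree)
    (hr : 3 ≤ r) (hq : 2 ≤ q) (hdeg : ∀ i < r, T.degree (v i) = q) {k : ℕ} (hk : 2 ≤ k)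
    (hkr : k ≤ r + 1) :
    ∃ S : Finset V, IsKDistMutualVisSet T k ↑S ∧ S.card = (k - 1) * (q - 2) + 2 := by
  classical
  refine ⟨(Finset.univ.filter fun x => ht x = 1 ∧ pos x ∈ Finset.range (k - 1)) ∪
    (Finset.univ.filter fun x => ht x = 0 ∧ pos x + 1 = k), ?_, ?_⟩
  · intro x hx y hy
    rw [hT.sKVisible_iff]
    by_cases hxy : x = y
    · subst hxy
      refine ⟨by simp, fun z _ hz => Or.inl ?_⟩
      rw [dist_self] at hz
      exact ((hT.connected.dist_eq_zero_iff).1 (by omega : T.dist z x = 0))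
    rw [hc.dist_eq hT hxy]
    have hx0 : ∀ {a b : V}, a ≠ b → ht a = 0 → ht b = 0 → pos a ≠ pos b :=
      fun hab ha hb h => hab (hc.eq_of_pos_eq ha hb h)
    simp only [Finset.coe_union, Finset.coe_filter, Finset.mem_univ, true_and, Finset.mem_range,
      Set.mem_union, Set.mem_ofPred_eq] at hx hy ⊢
    refine ⟨?_, fun z hz hd => ?_⟩
    · have := hx0 hxy
      omega
    · by_contra! hne
      rw [hc.dist_eq hT hne.1.symm, hc.dist_eq hT hne.2] at hd
      have := hx0 hne.1
      have := hx0 hne.2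
      omega
  · rw [Finset.card_union_of_disjoint, hc.card_leaves hr hq hdeg
      (by intro i hi; rw [Finset.mem_range] at hi; omega), Finset.card_range]
    · have h0 : 0 ∈ Finset.range (k - 1) := by rw [Finset.mem_range]; omega
      rw [if_pos h0]
      by_cases hk' : k = r + 1
      · have h1 : r - 1 ∈ Finset.range (k - 1) := by rw [Finset.mem_range]; omega
        rw [if_pos h1, Finset.filter_eq_empty_iff.2, Finset.card_empty]
        intro x _
        have := hc.pos_lt x
        omega
      · have h1 : r - 1 ∉ Finset.range (k - 1) := by rw [Finset.mem_range]; omega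
        have h2 : (Finset.univ.filter fun x => ht x = 0 ∧ pos x + 1 = k) = {v (k - 1)} := by
          have hp := hc.pos_v (k - 1) (by omega)
          have hv := hc.ht_v (k - 1) (by omega)
          ext x
          simp only [Finset.mem_filter, Finset.mem_univ, true_and, Finset.mem_singleton]
          constructor
          · rintro ⟨h, h'⟩
            exact hc.eq_of_pos_eq h hv (by omega)
          · rintro rfl
            exact ⟨hv, by omega⟩
        rw [if_neg h1, h2, Finset.card_singleton]
    · rw [Finset.disjoint_left]
      intro x hx hx'
      simp only [Finset.mem_filter] at hx hx'
      omega

theorem card_le_of_isKDistMutualVisSet (hc : CaterpillarCoord T r v pos ht) (hT : T.IsTree)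
    (hr : 3 ≤ r) (hq : 2 ≤ q) (hdeg : ∀ i < r, T.degree (v i) = q) {k : ℕ} (hk : 2 ≤ k)
    {S : Finset V} (hS : IsKDistMutualVisSet T k ↑S) : S.card ≤ (k - 1) * (q - 2) + 2 := by
  classical
  by_cases h3 : S.card ≤ 2
  · omega
  push Not at h3
  have hSne : S.Nonempty := Finset.card_pos.1 (by omega)
  obtain ⟨a, ha, hmin⟩ := S.exists_min_image pos hSne
  obtain ⟨b, hb, hmax⟩ := S.exists_max_image pos hSne
  have hvis : ∀ x ∈ S, ∀ y ∈ S, x ≠ y → ht x + ht y + ((pos x - pos y) + (pos y - pos x)) ≤ k ∧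
      ∀ z ∈ S, z ≠ x → z ≠ y → ht z = 0 →
        ¬ ((pos x ≤ pos z ∧ pos z ≤ pos y) ∨ (pos y ≤ pos z ∧ pos z ≤ pos x)) := by
    intro x hx y hy hxy
    obtain ⟨h₁, h₂⟩ := hT.sKVisible_iff.1 (hS (Finset.mem_coe.2 hx) (Finset.mem_coe.2 hy))
    rw [hc.dist_eq hT hxy] at h₁ h₂
    refine ⟨h₁, fun z hz hzx hzy h0 hle => ?_⟩
    have := h₂ z (Finset.mem_coe.2 hz)
    rw [hc.dist_eq hT hzx.symm, hc.dist_eq hT hzy] at this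
    rcases this (by omega) with h | h
    · exact hzx h
    · exact hzy h
  -- A spine vertex of `S` is alone at its position.
  have halone : ∀ s ∈ S, ht s = 0 → ∀ x ∈ S, pos x = pos s → x = s := by
    intro s hs h0 x hx hp
    by_contra hne
    obtain ⟨y, hy, hys⟩ : ∃ y ∈ S, y ∉ ({s, x} : Finset V) :=
      Finset.exists_mem_notMem_of_card_lt_card (lt_of_le_of_lt Finset.card_le_two h3)
    simp only [Finset.mem_insert, Finset.mem_singleton, not_or] at hys
    have := (hvis x hx y hy (Ne.symm hys.2)).2 s hs (Ne.symm hne) (Ne.symm hys.1) h0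
    omega
  have hends : ∀ s ∈ S, ht s = 0 → s = a ∨ s = b := by
    intro s hs h0
    by_contra! hne
    have h1 := hmin s hs
    have h2 := hmax s hs
    by_cases hab : a = b
    · subst hab
      exact hne.1 (halone s hs h0 a ha (by omega)).symm
    · exact (hvis a ha b hb hab).2 s hs hne.1 hne.2 h0 (Or.inl ⟨h1, h2⟩)
  have hbr := hc.pos_lt b
  have hab := hmin b hb
  have key : ∀ (W : Finset ℕ), (∀ i ∈ W, i < r) → (∀ x ∈ S, ht x = 1 → pos x ∈ W) →
      (S.filter fun x => ht x = 1).card ≤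
        W.card * (q - 2) + ((if 0 ∈ W then 1 else 0) + if r - 1 ∈ W then 1 else 0) := by
    intro W hW hSW
    rw [← hc.card_leaves hr hq hdeg hW]
    refine Finset.card_le_card fun x hx => ?_
    rw [Finset.mem_filter] at hx ⊢
    exact ⟨Finset.mem_univ x, hx.2, hSW x hx.1 hx.2⟩
  have hsplit : S.card = (S.filter fun x => ht x = 1).card + (S.filter fun x => ht x = 0).card := by
    rw [← Finset.card_filter_add_card_filter_not (s := S) (fun x => ht x = 1)]
    congr 2
    refine Finset.filter_congr fun x _ => ?_
    have := hc.ht_cases x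
    omega
  have hmono : ∀ m, m + 1 ≤ k → m * (q - 2) ≤ (k - 1) * (q - 2) := fun m hm =>
    Nat.mul_le_mul_right _ (by omega)
  have hne : a ≠ b ∨ (a = b ∧ ht a = 1) := by
    by_cases h : a = b
    · refine Or.inr ⟨h, (hc.ht_cases a).resolve_left fun h0 => ?_⟩
      have : S ⊆ {a} := fun x hx => by
        rw [Finset.mem_singleton]
        exact halone a ha h0 x hx (le_antisymm (h ▸ hmax x hx) (hmin x hx))
      have := Finset.card_le_card this
      rw [Finset.card_singleton] at this
      omega
    · exact Or.inl h
  have hlt : ∀ s ∈ S, ht s = 0 → ∀ x ∈ S, ht x = 1 → pos x ≠ pos s := by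
    intro s hs h0 x hx h1 hp
    have := halone s hs h0 x hx hp
    rw [this] at h1
    omega
  rcases hc.ht_cases a with ha0 | ha1 <;> rcases hc.ht_cases b with hb0 | hb1
  · have hne' : a ≠ b := hne.resolve_right fun h => by omega
    have hpab : pos a ≠ pos b := fun h => hne' (hc.eq_of_pos_eq ha0 hb0 h)
    have h₁ := (hvis a ha b hb hne').1
    have h₂ := key (Finset.Ioo (pos a) (pos b)) (fun i hi => by rw [Finset.mem_Ioo] at hi; omega)
      (fun x hx h1 => by
        rw [Finset.mem_Ioo]
        have := hmin x hx
        have := hmax x hx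
        have := hlt a ha ha0 x hx h1
        have := hlt b hb hb0 x hx h1
        omega)
    rw [if_neg (by rw [Finset.mem_Ioo]; omega), if_neg (by rw [Finset.mem_Ioo]; omega),
      Nat.card_Ioo] at h₂
    have h₃ : (S.filter fun x => ht x = 0).card ≤ 2 := by
      refine le_trans (Finset.card_le_card (t := {a, b}) fun x hx => ?_) Finset.card_le_two
      rw [Finset.mem_filter] at hx
      simpa using hends x hx.1 hx.2
    have := hmono (pos b - pos a - 1) (by omega)
    omega
  · have hne' : a ≠ b := by rintro rfl; omega
    have h₁ := (hvis a ha b hb hne').1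
    have h₂ := key (Finset.Ioc (pos a) (pos b)) (fun i hi => by rw [Finset.mem_Ioc] at hi; omega)
      (fun x hx h1 => by
        rw [Finset.mem_Ioc]
        have := hmin x hx
        have := hmax x hx
        have := hlt a ha ha0 x hx h1
        omega)
    rw [if_neg (by rw [Finset.mem_Ioc]; omega), Nat.card_Ioc] at h₂
    have h₃ : (S.filter fun x => ht x = 0).card ≤ 1 := by
      refine le_trans (Finset.card_le_card (t := {a}) fun x hx => ?_) (Finset.card_singleton _).le
      rw [Finset.mem_filter] at hx
      rw [Finset.mem_singleton]
      rcases hends x hx.1 hx.2 with h | rfl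
      · exact h
      · omega
    have := hmono (pos b - pos a) (by omega)
    split_ifs at h₂ <;> omega
  · have hne' : a ≠ b := by rintro rfl; omega
    have h₁ := (hvis a ha b hb hne').1
    have h₂ := key (Finset.Ico (pos a) (pos b)) (fun i hi => by rw [Finset.mem_Ico] at hi; omega)
      (fun x hx h1 => by
        rw [Finset.mem_Ico]
        have := hmin x hx
        have := hmax x hx
        have := hlt b hb hb0 x hx h1
        omega)
    rw [if_neg (c := r - 1 ∈ _) (by rw [Finset.mem_Ico]; omega), Nat.card_Ico] at h₂
    have h₃ : (S.filter fun x => ht x = 0).card ≤ 1 := by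
      refine le_trans (Finset.card_le_card (t := {b}) fun x hx => ?_) (Finset.card_singleton _).le
      rw [Finset.mem_filter] at hx
      rw [Finset.mem_singleton]
      rcases hends x hx.1 hx.2 with rfl | h
      · omega
      · exact h
    have := hmono (pos b - pos a) (by omega)
    split_ifs at h₂ <;> omega
  · have h₂ := key (Finset.Icc (pos a) (pos b)) (fun i hi => by rw [Finset.mem_Icc] at hi; omega)
      (fun x hx _ => Finset.mem_Icc.2 ⟨hmin x hx, hmax x hx⟩)
    rw [Nat.card_Icc] at h₂
    have h₃ : (S.filter fun x => ht x = 0) = ∅ := by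
      rw [Finset.filter_eq_empty_iff]
      intro x hx h0
      rcases hends x hx h0 with rfl | rfl <;> omega
    rw [h₃, Finset.card_empty] at hsplit
    have := hmono (pos b + 1 - pos a) (by
      by_cases h : a = b
      · subst h; omega
      · have := (hvis a ha b hb h).1
        omega)
    split_ifs at h₂ <;> omega

theorem kdistMu_eq (hc : CaterpillarCoord T r v pos ht) (hT : T.IsTree)
    (hr : 3 ≤ r) (hq : 2 ≤ q) (hdeg : ∀ i < r, T.degree (v i) = q) {k : ℕ} (hk : 2 ≤ k)
    (hkr : k ≤ r + 1) : kdistMu T k = (k - 1) * (q - 2) + 2 := by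
  refine IsGreatest.csSup_eq ⟨hc.exists_isKDistMutualVisSet hT hr hq hdeg hk hkr, ?_⟩
  rintro n ⟨S, hS, rfl⟩
  exact hc.card_le_of_isKDistMutualVisSet hT hr hq hdeg hk hS

end CaterpillarCoord

end SimpleGraph

/-- Let `T` be a caterpillar tree whose set `B` of non-leaf vertices induces a path on
`r = diam(T) - 1 ≥ 3` vertices and all of whose non-leaf vertices have degree `q ≥ 2`.
Then for `2 ≤ k ≤ diam(T) = r + 1`, `μ_k(T) = k(q-2) - q + 4`. -/
theorem stmt9 {V : Type*} [Fintype V] (T : SimpleGraph V) [DecidableRel T.Adj]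
    (hT : T.IsTree) (r q k : ℕ)
    (B : Set V) (hB : B = {v : V | 1 < T.degree v})
    (hdiam : T.diam = r + 1) (hr : 3 ≤ r)
    (hpath : Nonempty ((T.induce B) ≃g SimpleGraph.pathGraph r))
    (hq : 2 ≤ q) (hdeg : ∀ v ∈ B, T.degree v = q)
    (hk2 : 2 ≤ k) (hkd : k ≤ r + 1) :
    (kdistMu T k : ℤ) = k * (q - 2) - q + 4 := by
  subst hB
  obtain ⟨φ⟩ := hpath
  obtain ⟨v, pos, ht, hc, hB⟩ := exists_caterpillarCoord hT.connected (by omega) φ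
  rw [hc.kdistMu_eq hT hr hq (fun i hi => hdeg _ ((hB _).1 (hc.ht_v i hi))) hk2 hkd]
  push_cast [Nat.cast_sub hq, Nat.cast_sub (by omega : 1 ≤ k)]
  ring
end

section
/- Let T be a perfect tree with maximum degree Δ ≥ 2, i.e. a tree such that for every leaf i there exists a leaf j with d(i,j) = diam(T), and all non-leaf vertices of T have the same degree Δ. Let k be an integer with 2 ≤ k ≤ diam(T). Then μ_k(T) = Δ·(Δ−1)^{(k−2)/2} if k is even, and μ_k(T) = 2·(Δ−1)^{(k−1)/2} if k is odd. -/
open SimpleGraph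

namespace SimpleGraph

variable {V : Type*} {T : SimpleGraph V}

lemma Walk.dist_add_dist_of_mem_support {x y z : V} {p : T.Walk x y}
    (hp : p.length = T.dist x y) (hz : z ∈ p.support) :
    T.dist x z + T.dist z y = T.dist x y := by
  obtain ⟨q, r, rfl⟩ := Walk.mem_support_iff_exists_append.1 hz
  have h₁ := dist_le q
  have h₂ := dist_le r
  have h₃ := Reachable.dist_triangle_left q.reachable y
  rw [Walk.length_append] at hp
  omega

lemma Connected.exists_dist_add_dist_eq (hT : T.Connected) (x y : V) {n : ℕ}
    (hn : n ≤ T.dist x y) :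
    ∃ z, T.dist x z = n ∧ n + T.dist z y = T.dist x y := by
  obtain ⟨p, hp⟩ := hT.exists_walk_length_eq_dist x y
  have h₁ := dist_le (p.take n)
  have h₂ := dist_le (p.drop n)
  have h₃ := hT.dist_triangle (u := x) (v := p.getVert n) (w := y)
  rw [Walk.take_length] at h₁
  rw [Walk.drop_length] at h₂
  exact ⟨p.getVert n, by omega, by omega⟩

lemma Connected.exists_adj_dist_add_one_eq (hT : T.Connected) {x y : V} (hxy : x ≠ y) :
    ∃ z, T.Adj x z ∧ T.dist x y = T.dist z y + 1 := by
  obtain ⟨z, hz, h⟩ := hT.exists_dist_add_dist_eq x y (hT.pos_dist_of_ne hxy)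
  exact ⟨z, dist_eq_one_iff_adj.1 hz, by omega⟩

namespace IsTree

lemma dist_eq_length (hT : T.IsTree) {x y : V} {p : T.Walk x y} (hp : p.IsPath) :
    p.length = T.dist x y := by
  obtain ⟨q, hq, hq'⟩ := hT.connected.exists_path_of_dist x y
  rw [← hq', (hT.existsUnique_path x y).unique hp hq]

lemma dist_eq_dist_add_one_add_dist (hT : T.IsTree) {u v x y : V} (h : T.Adj u v)
    (hx : T.dist u x = T.dist v x + 1) (hy : T.dist v y = T.dist u y + 1) :
    T.dist x y = T.dist v x + 1 + T.dist u y := by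
  obtain ⟨p, hp, hp'⟩ := hT.connected.exists_path_of_dist v x
  obtain ⟨q, hq, hq'⟩ := hT.connected.exists_path_of_dist u y
  have hpath : (p.reverse.append (Walk.cons h.symm q)).IsPath := by
    rw [Walk.isPath_def, Walk.support_append, Walk.support_cons, List.tail_cons,
      List.nodup_append]
    refine ⟨hp.reverse.support_nodup, hq.support_nodup, ?_⟩
    rintro z hz _ hz' rfl
    rw [Walk.support_reverse, List.mem_reverse] at hz
    have h₁ := Walk.dist_add_dist_of_mem_support hp' hz
    have h₂ := Walk.dist_add_dist_of_mem_support hq' hz'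
    have h₃ := hT.connected.dist_triangle (u := u) (v := z) (w := x)
    have h₄ := hT.connected.dist_triangle (u := v) (v := z) (w := y)
    omega
  rw [← hT.dist_eq_length hpath, Walk.length_append, Walk.length_reverse, Walk.length_cons]
  omega

lemma dist_adj_cases (hT : T.IsTree) {u v : V} (h : T.Adj u v) (w : V) :
    T.dist u w = T.dist v w + 1 ∨ T.dist v w = T.dist u w + 1 := by
  simpa only [dist_comm] using hT.dist_eq_dist_add_one_of_adj w h

/-- A vertex on a geodesic of a tree separates any vertex from one of the two ends. -/
lemma dist_add_dist_eq_or (hT : T.IsTree) {a b c : V}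
    (hc : T.dist c a + T.dist c b = T.dist a b) (w : V) :
    T.dist c w + T.dist c a = T.dist w a ∨ T.dist c w + T.dist c b = T.dist w b := by
  by_cases hw : c = w
  · subst hw; simp
  obtain ⟨n, hn, hd⟩ := hT.connected.exists_adj_dist_add_one_eq hw
  rcases hT.dist_adj_cases hn a with ha | ha
  · rcases hT.dist_adj_cases hn b with hb | hb
    · have := hT.connected.dist_triangle (u := a) (v := n) (w := b)
      rw [dist_comm (u := a) (v := n)] at this
      omega
    · right
      have := hT.dist_eq_dist_add_one_add_dist hn hd hb
      omega
  · left
    have := hT.dist_eq_dist_add_one_add_dist hn hd ha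
    omega

lemma dist_eq_two (hT : T.IsTree) {u v w : V} (hu : T.Adj v u) (hw : T.Adj v w) (huw : u ≠ w) :
    T.dist u w = 2 := by
  have h₁ := hT.dist_adj_cases hu w
  have h₂ := dist_eq_one_iff_adj.2 hw
  have h₃ := hT.connected.pos_dist_of_ne huw
  omega

lemma skVisible_iff (hT : T.IsTree) {S : Set V} {k : ℕ} {x y : V} :
    SKVisible T S k x y ↔ T.dist x y ≤ k ∧
      ∀ z ∈ S, T.dist x z + T.dist z y = T.dist x y → z = x ∨ z = y := by
  constructor
  · rintro ⟨p, hp, hd, hk, h⟩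
    refine ⟨hd ▸ hk, fun z hz hxy ↦ h z ?_ hz⟩
    obtain ⟨q, hq⟩ := hT.connected.exists_walk_length_eq_dist x z
    obtain ⟨r, hr⟩ := hT.connected.exists_walk_length_eq_dist z y
    have hqr : (q.append r).IsPath :=
      Walk.isPath_of_length_eq_dist _ (by rw [Walk.length_append]; omega)
    rw [(hT.existsUnique_path x y).unique hp hqr]
    simp
  · rintro ⟨hk, h⟩
    obtain ⟨p, hp, hd⟩ := hT.connected.exists_path_of_dist x y
    exact ⟨p, hp, hd, hd ▸ hk, fun v hv hvS ↦
      h v hvS (Walk.dist_add_dist_of_mem_support hd hv)⟩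

lemma branch_disjoint (hT : T.IsTree) {v w w' x : V} (hw : T.Adj v w) (hw' : T.Adj v w')
    (hx : T.dist v x = T.dist w x + 1) (hx' : T.dist v x = T.dist w' x + 1) : w = w' := by
  by_contra hne
  have h₁ := hT.dist_eq_two hw hw' hne
  have h₂ := dist_eq_one_iff_adj.2 hw'
  have h₃ := hT.dist_eq_dist_add_one_add_dist hw hx (by omega : T.dist w w' = _)
  rw [dist_comm] at h₃
  omega

section Counting

variable [Fintype V] [DecidableRel T.Adj]

/-- In a tree, an antichain of depth at most `r` in the branch hanging from `u` at `v`. -/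
lemma card_le_pow_of_antichain (hT : T.IsTree) {q : ℕ} (hq : 1 ≤ q)
    (hdeg : ∀ v, T.degree v ≤ q + 1) (r : ℕ) {u v : V} (huv : T.Adj u v) (S : Finset V)
    (hS : ∀ x ∈ S, T.dist u x = T.dist v x + 1) (hr : ∀ x ∈ S, T.dist v x ≤ r)
    (hanti : ∀ x ∈ S, ∀ y ∈ S, T.dist v x + T.dist x y = T.dist v y → x = y) :
    S.card ≤ q ^ r := by
  classical
  induction r generalizing u v S with
  | zero =>
    rw [pow_zero, Finset.card_le_one_iff]
    intro x y hx hy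
    have h₁ := hT.connected.dist_eq_zero_iff.1 (Nat.le_zero.1 (hr x hx))
    have h₂ := hT.connected.dist_eq_zero_iff.1 (Nat.le_zero.1 (hr y hy))
    exact h₁.symm.trans h₂
  | succ r ih =>
    by_cases hv : v ∈ S
    · refine le_trans ?_ (Nat.one_le_pow _ _ hq)
      rw [Finset.card_le_one_iff]
      intro x y hx hy
      rw [← hanti v hv x hx (by simp), ← hanti v hv y hy (by simp)]
    · have hsub : S ⊆ ((T.neighborFinset v).erase u).biUnion
          fun w ↦ S.filter fun x ↦ T.dist v x = T.dist w x + 1 := by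
        intro x hx
        obtain ⟨w, hw, hd⟩ := hT.connected.exists_adj_dist_add_one_eq
          (show v ≠ x by rintro rfl; exact hv hx)
        have := hS x hx
        simp only [Finset.mem_biUnion, Finset.mem_erase, mem_neighborFinset, Finset.mem_filter]
        exact ⟨w, ⟨by rintro rfl; omega, hw⟩, hx, hd⟩
      have hcard : ((T.neighborFinset v).erase u).card ≤ q := by
        rw [Finset.card_erase_of_mem (by simpa using huv.symm), card_neighborFinset_eq_degree]
        have := hdeg v
        omega
      calc S.card ≤ _ := Finset.card_le_card hsub
        _ ≤ ((T.neighborFinset v).erase u).card * q ^ r := by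
          refine Finset.card_biUnion_le_card_mul _ _ _ fun w hw ↦ ?_
          simp only [Finset.mem_erase, mem_neighborFinset] at hw
          refine ih hw.2 _ (fun x hx ↦ (Finset.mem_filter.1 hx).2) (fun x hx ↦ ?_)
            fun x hx y hy hxy ↦ ?_
          · rw [Finset.mem_filter] at hx
            have := hr x hx.1
            omega
          · rw [Finset.mem_filter] at hx hy
            exact hanti x hx.1 y hy.1 (by omega)
        _ ≤ q * q ^ r := Nat.mul_le_mul_right _ hcard
        _ = q ^ (r + 1) := (pow_succ' q r).symm

lemma card_branch_sphere (hT : T.IsTree) {q : ℕ} (r : ℕ) {u v : V} (huv : T.Adj u v)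
    (hdeg : ∀ z, T.dist u z = T.dist v z + 1 → T.dist v z < r → T.degree z = q + 1) :
    (Finset.univ.filter fun x ↦ T.dist v x = r ∧ T.dist u x = r + 1).card = q ^ r := by
  classical
  have hbranch : ∀ w, w ≠ u → T.Adj v w → ∀ z, T.dist v z = T.dist w z + 1 →
      T.dist u z = T.dist v z + 1 := by
    intro w hwu hw z hz
    have h₁ := hT.dist_eq_two hw huv.symm hwu
    have h₂ := dist_eq_one_iff_adj.2 huv.symm
    have h₃ := hT.dist_eq_dist_add_one_add_dist hw hz (by omega : T.dist w u = _)
    rw [dist_comm (u := z)] at h₃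
    omega
  induction r generalizing u v with
  | zero =>
    rw [pow_zero, Finset.card_eq_one]
    refine ⟨v, Finset.ext fun x ↦ ?_⟩
    simp only [Finset.mem_filter, Finset.mem_univ, true_and, Finset.mem_singleton]
    constructor
    · exact fun h ↦ (hT.connected.dist_eq_zero_iff.1 h.1).symm
    · rintro rfl
      exact ⟨by simp, dist_eq_one_iff_adj.2 huv⟩
  | succ r ih =>
    have heq : (Finset.univ.filter fun x ↦ T.dist v x = r + 1 ∧ T.dist u x = r + 1 + 1) =
        ((T.neighborFinset v).erase u).biUnion fun w ↦
          Finset.univ.filter fun x ↦ T.dist w x = r ∧ T.dist v x = r + 1 := by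
      ext x
      simp only [Finset.mem_biUnion, Finset.mem_erase, mem_neighborFinset, Finset.mem_filter,
        Finset.mem_univ, true_and]
      constructor
      · rintro ⟨h₁, h₂⟩
        obtain ⟨w, hw, hd⟩ := hT.connected.exists_adj_dist_add_one_eq
          (show v ≠ x by rintro rfl; simp at h₁)
        exact ⟨w, ⟨by rintro rfl; omega, hw⟩, by omega, h₁⟩
      · rintro ⟨w, ⟨hwu, hw⟩, h₁, h₂⟩
        have := hbranch w hwu hw x (by omega)
        omega
    rw [heq, Finset.card_biUnion]
    · have hsum : ∀ w ∈ (T.neighborFinset v).erase u,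
          (Finset.univ.filter fun x ↦ T.dist w x = r ∧ T.dist v x = r + 1).card = q ^ r := by
        intro w hw
        simp only [Finset.mem_erase, mem_neighborFinset] at hw
        refine ih hw.2 (fun z hz hzr ↦ hdeg z (hbranch w hw.1 hw.2 z hz) (by omega)) ?_
        intro w' hw'v hw' z hz
        have h₁ := hT.dist_eq_two hw' hw.2.symm hw'v
        have h₂ := dist_eq_one_iff_adj.2 hw.2.symm
        have h₃ := hT.dist_eq_dist_add_one_add_dist hw' hz (by omega : T.dist w' v = _)
        rw [dist_comm (u := z)] at h₃
        omega
      rw [Finset.sum_congr rfl hsum, Finset.sum_const, smul_eq_mul,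
        Finset.card_erase_of_mem (by simpa using huv.symm), card_neighborFinset_eq_degree,
        hdeg v (by simpa using dist_eq_one_iff_adj.2 huv) (by simp), pow_succ']
      simp
    · intro w hw w' hw' hne
      simp only [Finset.coe_erase, coe_neighborFinset, Set.mem_sdiff, mem_neighborSet] at hw hw'
      rw [Function.onFun, Finset.disjoint_left]
      intro x hx hx'
      simp only [Finset.mem_filter, Finset.mem_univ, true_and] at hx hx'
      exact hne (hT.branch_disjoint (x := x) hw.1 hw'.1 (by omega) (by omega))

lemma card_sphere (hT : T.IsTree) {q : ℕ} (r : ℕ) (c : V)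
    (hdeg : ∀ z, T.dist c z < r + 1 → T.degree z = q + 1) :
    (Finset.univ.filter fun x ↦ T.dist c x = r + 1).card = (q + 1) * q ^ r := by
  classical
  have heq : (Finset.univ.filter fun x ↦ T.dist c x = r + 1) =
      (T.neighborFinset c).biUnion fun w ↦
        Finset.univ.filter fun x ↦ T.dist w x = r ∧ T.dist c x = r + 1 := by
    ext x
    simp only [Finset.mem_biUnion, mem_neighborFinset, Finset.mem_filter,
      Finset.mem_univ, true_and]
    constructor
    · intro h₁
      obtain ⟨w, hw, hd⟩ := hT.connected.exists_adj_dist_add_one_eq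
        (show c ≠ x by rintro rfl; simp at h₁)
      exact ⟨w, hw, by omega, h₁⟩
    · rintro ⟨w, -, -, h⟩
      exact h
  rw [heq, Finset.card_biUnion]
  · have hsum : ∀ w ∈ T.neighborFinset c,
        (Finset.univ.filter fun x ↦ T.dist w x = r ∧ T.dist c x = r + 1).card = q ^ r := by
      intro w hw
      rw [mem_neighborFinset] at hw
      exact hT.card_branch_sphere r hw fun z hz hzr ↦ hdeg z (by omega)
    rw [Finset.sum_congr rfl hsum, Finset.sum_const, smul_eq_mul,
      card_neighborFinset_eq_degree, hdeg c (by simp)]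
  · intro w hw w' hw' hne
    simp only [coe_neighborFinset, mem_neighborSet] at hw hw'
    rw [Function.onFun, Finset.disjoint_left]
    intro x hx hx'
    simp only [Finset.mem_filter, Finset.mem_univ, true_and] at hx hx'
    exact hne (hT.branch_disjoint (x := x) hw hw' (by omega) (by omega))

end Counting

/-- Seen from a vertex `c` on a geodesic between two visible points of `S`, the points of
a mutual-visibility set `S` other than `c` form an antichain. -/
lemma eq_of_dist_add_dist_eq (hT : T.IsTree) {S : Set V} {k : ℕ}
    (hS : IsKDistMutualVisSet T k S) {a b c x y : V} (ha : a ∈ S) (hb : b ∈ S)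
    (hc : T.dist c a + T.dist c b = T.dist a b) (hx : x ∈ S) (hy : y ∈ S) (hxc : x ≠ c)
    (hxy : T.dist c x + T.dist x y = T.dist c y) : x = y := by
  have key : ∀ z ∈ S, T.dist c y + T.dist c z = T.dist y z → x = y := by
    intro z hz h
    have h₁ := hT.connected.dist_triangle (u := y) (v := x) (w := z)
    have h₂ := hT.connected.dist_triangle (u := x) (v := c) (w := z)
    have h₃ := dist_comm (G := T) (u := x) (v := y)
    have h₄ := dist_comm (G := T) (u := x) (v := c)
    rcases (hT.skVisible_iff.1 (hS hy hz)).2 x hx (by omega) with h' | rfl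
    · exact h'
    · have : T.dist c x = 0 := by omega
      exact absurd (hT.connected.dist_eq_zero_iff.1 this).symm hxc
  rcases hT.dist_add_dist_eq_or hc y with h | h
  exacts [key a ha h, key b hb h]

lemma sphere_isKDistMutualVisSet [Fintype V] (hT : T.IsTree) (c : V) (r : ℕ) :
    IsKDistMutualVisSet T (2 * r)
      (Finset.univ.filter fun x ↦ T.dist c x = r : Finset V) := by
  intro x hx y hy
  simp only [Finset.coe_filter, Finset.mem_univ, true_and, Set.mem_ofPred_eq] at hx hy
  rw [hT.skVisible_iff]
  constructor
  · have := hT.connected.dist_triangle (u := x) (v := c) (w := y)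
    rw [dist_comm (u := x) (v := c)] at this
    omega
  · intro z hz hxy
    simp only [Finset.coe_filter, Finset.mem_univ, true_and, Set.mem_ofPred_eq] at hz
    rw [dist_comm (u := x) (v := z)] at hxy
    rcases hT.dist_add_dist_eq_or hxy c with h | h
    all_goals rw [dist_comm (u := z) (v := c)] at h
    · exact Or.inl (hT.connected.dist_eq_zero_iff.1 (by omega))
    · exact Or.inr (hT.connected.dist_eq_zero_iff.1 (by omega))

lemma edge_sphere_isKDistMutualVisSet (hT : T.IsTree) {u v : V} (huv : T.Adj u v) {r : ℕ}
    (hr : 1 ≤ r) {S : Set V}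
    (hS : ∀ x ∈ S, (T.dist u x = r ∧ T.dist v x = r + 1) ∨ T.dist v x = r ∧ T.dist u x = r + 1) :
    IsKDistMutualVisSet T (2 * r + 1) S := by
  have cross : ∀ x y, T.dist u x = r ∧ T.dist v x = r + 1 → T.dist v y = r ∧ T.dist u y = r + 1 →
      T.dist x y = 2 * r + 1 := by
    intro x y hx hy
    have := hT.dist_eq_dist_add_one_add_dist huv.symm (x := x) (y := y) (by omega) (by omega)
    omega
  intro x hx y hy
  rw [hT.skVisible_iff]
  constructor
  · have h₁ := hT.connected.dist_triangle (u := x) (v := u) (w := y)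
    have h₂ := hT.connected.dist_triangle (u := x) (v := v) (w := y)
    rw [dist_comm (u := x) (v := u)] at h₁
    rw [dist_comm (u := x) (v := v)] at h₂
    have h₃ := hS x hx
    have h₄ := hS y hy
    omega
  · intro z hz hxy
    have hsame : ∀ w ∈ S, T.dist z w ≤ 1 → T.dist u w = T.dist u z := by
      intro w hw hzw
      have h₁ := cross z w
      have h₂ := cross w z
      rw [dist_comm (u := w)] at h₂
      have h₃ := hS w hw
      have h₄ := hS z hz
      omega
    rw [dist_comm (u := x) (v := z)] at hxy
    have key : ∀ w ∈ S, T.dist z u + T.dist z w = T.dist u w → z = w := by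
      intro w hw h
      rw [dist_comm (u := z) (v := u)] at h
      have h₃ := hS w hw
      have h₄ := hS z hz
      have := hsame w hw (by omega)
      exact hT.connected.dist_eq_zero_iff.1 (by omega)
    rcases hT.dist_add_dist_eq_or hxy u with h | h
    exacts [Or.inl (key x hx h), Or.inr (key y hy h)]

lemma dist_le_diam [Finite V] (hT : T.IsTree) (x y : V) : T.dist x y ≤ T.diam := by
  have := hT.connected.nonempty
  exact SimpleGraph.dist_le_diam (connected_iff_ediam_ne_top.1 hT.connected)

section Bounds

variable [Fintype V] [DecidableRel T.Adj]

lemma card_le_of_even_diam (hT : T.IsTree) {q : ℕ} (hq : 1 ≤ q)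
    (hdeg : ∀ v, T.degree v ≤ q + 1) {S : Finset V} {k : ℕ}
    (hS : IsKDistMutualVisSet T k (S : Set V)) {a b : V} (ha : a ∈ S) (hb : b ∈ S)
    (hmax : ∀ x ∈ S, ∀ y ∈ S, T.dist x y ≤ T.dist a b) {j : ℕ}
    (hj : T.dist a b = 2 * (j + 1)) : S.card ≤ (q + 1) * q ^ j := by
  classical
  obtain ⟨c, hca, hcb⟩ := hT.connected.exists_dist_add_dist_eq a b (n := j + 1) (by omega)
  have hac := dist_comm (G := T) (u := a) (v := c)
  have hc : T.dist c a + T.dist c b = T.dist a b := by omega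
  have hcS : c ∉ S := by
    intro h
    rcases (hT.skVisible_iff.1 (hS ha hb)).2 c h (by omega) with rfl | rfl
    · simp at hca
    · rw [dist_self] at hcb; omega
  have hne : ∀ x ∈ S, x ≠ c := by rintro x hx rfl; exact hcS hx
  have hsub : S ⊆ (T.neighborFinset c).biUnion
      fun w ↦ S.filter fun x ↦ T.dist c x = T.dist w x + 1 := by
    intro x hx
    obtain ⟨w, hw, hd⟩ := hT.connected.exists_adj_dist_add_one_eq (hne x hx).symm
    simp only [Finset.mem_biUnion, mem_neighborFinset, Finset.mem_filter]
    exact ⟨w, hw, hx, hd⟩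
  calc S.card ≤ _ := Finset.card_le_card hsub
    _ ≤ (T.neighborFinset c).card * q ^ j := by
      refine Finset.card_biUnion_le_card_mul _ _ _ fun w hw ↦ ?_
      rw [mem_neighborFinset] at hw
      refine hT.card_le_pow_of_antichain hq hdeg j hw _ (fun x hx ↦ (Finset.mem_filter.1 hx).2)
        (fun x hx ↦ ?_) fun x hx y hy hxy ↦ ?_
      · rw [Finset.mem_filter] at hx
        have h₁ := hT.dist_add_dist_eq_or hc x
        have h₂ := hmax x hx.1 a ha
        have h₃ := hmax x hx.1 b hb
        omega
      · rw [Finset.mem_filter] at hx hy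
        exact hT.eq_of_dist_add_dist_eq hS ha hb hc hx.1 hy.1 (hne x hx.1) (by omega)
    _ ≤ _ := by
      rw [card_neighborFinset_eq_degree]
      exact Nat.mul_le_mul_right _ (hdeg c)

lemma card_le_of_odd_diam (hT : T.IsTree) {q : ℕ} (hq : 1 ≤ q)
    (hdeg : ∀ v, T.degree v ≤ q + 1) {S : Finset V} {k : ℕ}
    (hS : IsKDistMutualVisSet T k (S : Set V)) {a b : V} (ha : a ∈ S) (hb : b ∈ S)
    (hmax : ∀ x ∈ S, ∀ y ∈ S, T.dist x y ≤ T.dist a b) {j : ℕ}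
    (hj : T.dist a b = 2 * j + 1) : S.card ≤ 2 * q ^ j := by
  classical
  obtain ⟨c, hca, hcb⟩ := hT.connected.exists_dist_add_dist_eq a b (n := j) (by omega)
  obtain ⟨d, hcd, hdb⟩ := hT.connected.exists_dist_add_dist_eq c b (n := 1) (by omega)
  have hac := dist_comm (G := T) (u := a) (v := c)
  have had := dist_comm (G := T) (u := a) (v := d)
  have hadj : T.Adj c d := dist_eq_one_iff_adj.1 hcd
  have h₁ := hT.connected.dist_triangle (u := a) (v := c) (w := d)
  have h₂ := hT.connected.dist_triangle (u := a) (v := d) (w := b)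
  have branch : ∀ u v, T.Adj u v → T.dist u a + T.dist u b = T.dist a b →
      T.dist v a + T.dist v b = T.dist a b → j ≤ T.dist u a → j ≤ T.dist u b →
      (S.filter fun x ↦ T.dist u x = T.dist v x + 1).card ≤ q ^ j := by
    intro u v huv hu hv hja hjb
    refine hT.card_le_pow_of_antichain hq hdeg j huv _ (fun x hx ↦ (Finset.mem_filter.1 hx).2)
      (fun x hx ↦ ?_) fun x hx y hy hxy ↦ ?_
    · rw [Finset.mem_filter] at hx
      have h₁ := hT.dist_add_dist_eq_or hu x
      have h₂ := hmax x hx.1 a ha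
      have h₃ := hmax x hx.1 b hb
      omega
    · rw [Finset.mem_filter] at hx hy
      refine hT.eq_of_dist_add_dist_eq hS ha hb hu hx.1 hy.1 ?_ (by omega)
      rintro rfl
      simp at hx
  have hsub : S ⊆ (S.filter fun x ↦ T.dist c x = T.dist d x + 1) ∪
      S.filter fun x ↦ T.dist d x = T.dist c x + 1 := by
    intro x hx
    simpa [hx] using hT.dist_adj_cases hadj x
  have h₃ := branch c d hadj (by omega) (by omega) (by omega) (by omega)
  have h₄ := branch d c hadj.symm (by omega) (by omega) (by omega) (by omega)
  have h₅ := (Finset.card_le_card hsub).trans (Finset.card_union_le _ _)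
  omega

lemma card_le_of_isKDistMutualVisSet (hT : T.IsTree) {q : ℕ} (hq : 1 ≤ q)
    (hdeg : ∀ v, T.degree v ≤ q + 1) {S : Finset V} {k : ℕ}
    (hS : IsKDistMutualVisSet T k (S : Set V)) (r : ℕ) :
    (k = 2 * (r + 1) → S.card ≤ (q + 1) * q ^ r) ∧ (k = 2 * r + 1 → S.card ≤ 2 * q ^ r) := by
  rcases S.eq_empty_or_nonempty with rfl | hne
  · simp
  obtain ⟨⟨a, b⟩, hab, hmax⟩ := (S ×ˢ S).exists_max_image (fun p ↦ T.dist p.1 p.2)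
    (hne.product hne)
  rw [Finset.mem_product] at hab
  obtain ⟨ha, hb⟩ := hab
  replace hmax : ∀ x ∈ S, ∀ y ∈ S, T.dist x y ≤ T.dist a b :=
    fun x hx y hy ↦ hmax (x, y) (Finset.mem_product.2 ⟨hx, hy⟩)
  have hk : T.dist a b ≤ k := (hT.skVisible_iff.1 (hS ha hb)).1
  have hpow : 1 ≤ q ^ r := Nat.one_le_pow _ _ hq
  obtain h0 | ⟨j, hj⟩ | ⟨j, hj⟩ : T.dist a b = 0 ∨ (∃ j, T.dist a b = 2 * (j + 1)) ∨
      ∃ j, T.dist a b = 2 * j + 1 := by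
    rcases Nat.even_or_odd' (T.dist a b) with ⟨_ | j, h | h⟩
    exacts [Or.inl h, Or.inr (Or.inr ⟨0, h⟩), Or.inr (Or.inl ⟨j, h⟩), Or.inr (Or.inr ⟨j + 1, h⟩)]
  · have : S.card ≤ 1 := by
      rw [Finset.card_le_one_iff]
      intro x y hx hy
      have := hmax x hx y hy
      exact hT.connected.dist_eq_zero_iff.1 (by omega)
    constructor <;> intro _ <;> nlinarith
  · have h := hT.card_le_of_even_diam hq hdeg hS ha hb hmax hj
    refine ⟨fun hkr ↦ h.trans ?_, fun hkr ↦ h.trans ?_⟩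
    · exact Nat.mul_le_mul_left _ (Nat.pow_le_pow_right hq (by omega))
    · have h₁ : q ^ (j + 1) ≤ q ^ r := Nat.pow_le_pow_right hq (by omega)
      have h₂ : 1 * q ^ j ≤ q * q ^ j := Nat.mul_le_mul_right _ hq
      rw [pow_succ'] at h₁
      linarith
  · have h := hT.card_le_of_odd_diam hq hdeg hS ha hb hmax hj
    have h₁ : j ≤ r → q ^ j ≤ q ^ r := Nat.pow_le_pow_right hq
    refine ⟨fun hkr ↦ h.trans ?_, fun hkr ↦ h.trans ?_⟩
    · exact Nat.mul_le_mul (by omega) (h₁ (by omega))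
    · exact Nat.mul_le_mul_left _ (h₁ (by omega))

/-- In a complete tree, a vertex in the middle of a diametral geodesic is far from all leaves. -/
lemma le_dist_of_leaf (hT : T.IsTree)
    (hcomplete : ∀ v : V, T.degree v = 1 → ∃ w : V, T.degree w = 1 ∧ T.dist v w = T.diam)
    {a b c v : V} {h : ℕ} (hab : T.dist a b = T.diam)
    (hc : T.dist c a + T.dist c b = T.dist a b) (ha : h ≤ T.dist c a) (hb : h ≤ T.dist c b)
    (hv : T.degree v = 1) : h ≤ T.dist c v := by
  obtain ⟨w, -, hw⟩ := hcomplete v hv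
  have h₁ := hT.dist_add_dist_eq_or hc w
  have h₂ := hT.dist_le_diam w a
  have h₃ := hT.dist_le_diam w b
  have h₄ := hT.connected.dist_triangle (u := v) (v := c) (w := w)
  rw [dist_comm (u := v) (v := c)] at h₄
  omega

end Bounds

end IsTree

end SimpleGraph

/-- Let `T` be a perfect tree with maximum degree `Δ ≥ 2`: every leaf is at distance
`diam(T)` from some leaf, and every non-leaf vertex has degree `Δ`. Then for
`2 ≤ k ≤ diam(T)`, `μ_k(T) = Δ(Δ-1)^((k-2)/2)` if `k` is even and
`μ_k(T) = 2(Δ-1)^((k-1)/2)` if `k` is odd. -/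
theorem stmt10 {V : Type*} [Fintype V] (T : SimpleGraph V) [DecidableRel T.Adj]
    (hT : T.IsTree) (Δ k : ℕ)
    (hcomplete : ∀ v : V, T.degree v = 1 →
      ∃ w : V, T.degree w = 1 ∧ T.dist v w = T.diam)
    (hΔ : T.maxDegree = Δ) (hΔ2 : 2 ≤ Δ)
    (hdeg : ∀ v : V, T.degree v ≠ 1 → T.degree v = Δ)
    (hk2 : 2 ≤ k) (hkd : k ≤ T.diam) :
    (Even k → kdistMu T k = Δ * (Δ - 1) ^ ((k - 2) / 2)) ∧
    (Odd k → kdistMu T k = 2 * (Δ - 1) ^ ((k - 1) / 2)) := by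
  classical
  obtain ⟨q, rfl⟩ : ∃ q, Δ = q + 1 := ⟨Δ - 1, by omega⟩
  have hle : ∀ v, T.degree v ≤ q + 1 := fun v ↦ hΔ ▸ T.degree_le_maxDegree v
  have := hT.connected.nonempty
  obtain ⟨a, b, hab⟩ := T.exists_dist_eq_diam
  rw [Nat.add_sub_cancel]
  have near : ∀ c r, T.dist c a + T.dist c b = T.dist a b → r ≤ T.dist c a → r ≤ T.dist c b →
      ∀ z, T.dist c z < r → T.degree z = q + 1 := by
    intro c r hc ha hb z hz
    refine hdeg z fun h ↦ ?_
    have := hT.le_dist_of_leaf hcomplete hab hc ha hb h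
    omega
  constructor
  · rintro ⟨n, hn⟩
    obtain ⟨r, rfl⟩ : ∃ r, n = r + 1 := ⟨n - 1, by omega⟩
    rw [show (k - 2) / 2 = r by omega]
    refine IsGreatest.csSup_eq ⟨?_, ?_⟩
    · obtain ⟨c, hac, hcb⟩ := hT.connected.exists_dist_add_dist_eq a b (n := r + 1) (by omega)
      rw [dist_comm] at hac
      refine ⟨_, ?_, hT.card_sphere r c (near c (r + 1) (by omega) (by omega) (by omega))⟩
      rw [show k = 2 * (r + 1) by omega]
      exact hT.sphere_isKDistMutualVisSet c (r + 1)
    · rintro _ ⟨S, hS, rfl⟩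
      exact (hT.card_le_of_isKDistMutualVisSet (by omega) hle hS r).1 (by omega)
  · rintro ⟨r, hr⟩
    rw [show (k - 1) / 2 = r by omega]
    refine IsGreatest.csSup_eq ⟨?_, ?_⟩
    · obtain ⟨c, hac, hcb⟩ := hT.connected.exists_dist_add_dist_eq a b (n := r) (by omega)
      obtain ⟨d, hcd, hdb⟩ := hT.connected.exists_dist_add_dist_eq c b (n := 1) (by omega)
      have h₁ := hT.connected.dist_triangle (u := a) (v := c) (w := d)
      have h₂ := hT.connected.dist_triangle (u := a) (v := d) (w := b)
      rw [dist_comm (u := a) (v := d)] at h₁ h₂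
      have hca := dist_comm (G := T) (u := a) (v := c)
      have hadj : T.Adj c d := dist_eq_one_iff_adj.1 hcd
      have nearc := near c r (by omega) (by omega) (by omega)
      have neard := near d r (by omega) (by omega) (by omega)
      have h₃ := hT.card_branch_sphere r hadj fun z _ hz ↦ neard z hz
      have h₄ := hT.card_branch_sphere r hadj.symm fun z _ hz ↦ nearc z hz
      refine ⟨(Finset.univ.filter fun x ↦ T.dist c x = r ∧ T.dist d x = r + 1) ∪
        Finset.univ.filter fun x ↦ T.dist d x = r ∧ T.dist c x = r + 1, ?_, ?_⟩
      · rw [hr]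
        refine hT.edge_sphere_isKDistMutualVisSet hadj (by omega) fun x hx ↦ ?_
        simpa using hx
      · rw [Finset.card_union_of_disjoint, h₃, h₄, two_mul]
        rw [Finset.disjoint_left]
        intro x hx hx'
        simp only [Finset.mem_filter, Finset.mem_univ, true_and] at hx hx'
        omega
    · rintro _ ⟨S, hS, rfl⟩
      exact (hT.card_le_of_isKDistMutualVisSet (by omega) hle hS r).2 hr
end

section
/- Let G be a finite graph with n = |V(G)| ≥ 2 vertices, let P_r be the path on r ≥ 3 vertices, and let k be an integer with 2 ≤ k ≤ r−1. Then the k-distance mutual-visibility number of the corona product P_r ⊙ G satisfies μ_k(P_r ⊙ G) = (k−1)·n + 2. -/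
open SimpleGraph

/-- The corona product `G ⊙ H`: one copy of `G` together with a copy of `H` for each vertex
`a` of `G`, joining `a` to every vertex of its copy of `H`. -/
def corona {α β : Type*} (G : SimpleGraph α) (H : SimpleGraph β) :
    SimpleGraph (α ⊕ (α × β)) :=
  SimpleGraph.fromRel (fun x y =>
    (∃ a a' : α, x = Sum.inl a ∧ y = Sum.inl a' ∧ G.Adj a a') ∨
    (∃ (a : α) (b : β), x = Sum.inl a ∧ y = Sum.inr (a, b)) ∨
    (∃ (a : α) (b b' : β), x = Sum.inr (a, b) ∧ y = Sum.inr (a, b') ∧ H.Adj b b'))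

section Corona

variable {α β : Type*} {G : SimpleGraph α} {H : SimpleGraph β}

@[simp] lemma corona_adj_inl_inl (a a' : α) :
    (corona G H).Adj (Sum.inl a) (Sum.inl a') ↔ G.Adj a a' := by
  simp only [corona, SimpleGraph.fromRel_adj]
  constructor
  · rintro ⟨-, h⟩
    simpa [G.adj_comm a' a] using h
  · intro h
    exact ⟨by simpa using h.ne, Or.inl (Or.inl ⟨a, a', rfl, rfl, h⟩)⟩

@[simp] lemma corona_adj_inl_inr (a : α) (q : α × β) :
    (corona G H).Adj (Sum.inl a) (Sum.inr q) ↔ a = q.1 := by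
  obtain ⟨a', b⟩ := q
  simp only [corona, SimpleGraph.fromRel_adj]
  simp [eq_comm]

@[simp] lemma corona_adj_inr_inl (a : α) (q : α × β) :
    (corona G H).Adj (Sum.inr q) (Sum.inl a) ↔ q.1 = a := by
  rw [SimpleGraph.adj_comm, corona_adj_inl_inr, eq_comm]

@[simp] lemma corona_adj_inr_inr (p q : α × β) :
    (corona G H).Adj (Sum.inr p) (Sum.inr q) ↔ p.1 = q.1 ∧ H.Adj p.2 q.2 := by
  obtain ⟨a, b⟩ := p
  obtain ⟨a', b'⟩ := q
  simp only [corona, SimpleGraph.fromRel_adj]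
  constructor
  · rintro ⟨-, h⟩
    rcases h with h | h <;> simp at h
    · exact ⟨h.1.symm, h.2⟩
    · exact ⟨h.1, h.2.symm⟩
  · rintro ⟨h₁, h⟩
    obtain rfl : a = a' := h₁
    refine ⟨fun e => h.ne ?_, Or.inl (Or.inr (Or.inr ⟨a, b, b', rfl, rfl, h⟩))⟩
    simpa using e

end Corona

/-- An integer-valued function varying by at most one along edges varies by at most the length
along a walk. -/
lemma SimpleGraph.Walk.sub_le_length {V : Type*} {G : SimpleGraph V} {f : V → ℤ}
    (hf : ∀ x y, G.Adj x y → f y - f x ≤ 1) {x y : V} (p : G.Walk x y) :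
    f y - f x ≤ p.length := by
  induction p with
  | nil => simp
  | cons h p ih =>
    have := hf _ _ h
    rw [SimpleGraph.Walk.length_cons]
    push_cast
    linarith

/-- A walk whose length is attained by the increment of a function varying by at most one along
edges is a shortest path. -/
lemma SKVisible.of_walk {V : Type*} {G : SimpleGraph V} {S : Set V} {k : ℕ} {x y : V}
    (p : G.Walk x y) {f : V → ℤ} (hf : ∀ x y, G.Adj x y → f y - f x ≤ 1)
    (hp : (p.length : ℤ) = f y - f x) (hk : p.length ≤ k)
    (hS : ∀ v ∈ p.support, v ∈ S → v = x ∨ v = y) : SKVisible G S k x y := by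
  have hd : p.length = G.dist x y := by
    obtain ⟨q, hq⟩ := p.reachable.exists_walk_length_eq_dist
    have h₁ := q.sub_le_length hf
    have h₂ := G.dist_le p
    omega
  exact ⟨p, p.isPath_of_length_eq_dist hd, hd, hk, hS⟩

section CoronaPath

variable {W : Type*} {G : SimpleGraph W} {r : ℕ}

/-- The position along the path of a vertex of `P_r ⊙ G`, where a vertex in a copy of `G` is put
one step before its base point if that is at most `t`, and one step after it otherwise. -/
def coronaHeight (t : ℕ) : Fin r ⊕ (Fin r × W) → ℤ
  | Sum.inl m => m
  | Sum.inr q => if q.1.val ≤ t then q.1.val - 1 else q.1.val + 1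

lemma coronaHeight_sub_le (t : ℕ) (x y : Fin r ⊕ (Fin r × W))
    (h : (corona (SimpleGraph.pathGraph r) G).Adj x y) :
    coronaHeight t y - coronaHeight t x ≤ 1 := by
  rcases x with a | a <;> rcases y with b | b
  · simp only [corona_adj_inl_inl, SimpleGraph.pathGraph_adj] at h
    simp only [coronaHeight]
    omega
  · simp only [corona_adj_inl_inr] at h
    subst h
    simp only [coronaHeight]
    split_ifs <;> omega
  · simp only [corona_adj_inr_inl] at h
    subst h
    simp only [coronaHeight]
    split_ifs <;> omega
  · simp only [corona_adj_inr_inr] at h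
    simp only [coronaHeight, h.1]
    split_ifs <;> omega

/-- The base point in `P_r` of a vertex of `P_r ⊙ G`. -/
def coronaBase : Fin r ⊕ (Fin r × W) → Fin r
  | Sum.inl m => m
  | Sum.inr q => q.1

lemma inl_mem_support_of_lt_of_lt {b : Fin r} {x y : Fin r ⊕ (Fin r × W)}
    (p : (corona (SimpleGraph.pathGraph r) G).Walk x y)
    (hx : coronaBase x < b) (hy : b < coronaBase y) : Sum.inl b ∈ p.support := by
  induction p with
  | nil => exact absurd (hx.trans hy) (lt_irrefl _)
  | @cons x z y h p ih =>
    rw [SimpleGraph.Walk.support_cons, List.mem_cons]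
    right
    by_cases hz : coronaBase z < b
    · exact ih hz hy
    · have hzb : z = Sum.inl b := by
        rcases x with a | a <;> rcases z with c | c
        · simp only [corona_adj_inl_inl, SimpleGraph.pathGraph_adj] at h
          simp only [coronaBase, Fin.lt_def] at hx hz
          congr 1
          ext
          omega
        · simp only [corona_adj_inl_inr] at h
          exact absurd (show c.1 < b from h ▸ hx) hz
        · simp only [corona_adj_inr_inl] at h
          exact absurd (h ▸ hx) hz
        · simp only [corona_adj_inr_inr] at h
          exact absurd (show c.1 < b from h.1 ▸ hx) hz
      exact hzb ▸ p.start_mem_support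

lemma exists_walk_inl_inl {i j : Fin r} (hij : i ≤ j) :
    ∃ p : (corona (SimpleGraph.pathGraph r) G).Walk (Sum.inl i) (Sum.inl j),
      p.length = j.val - i.val ∧
        ∀ v ∈ p.support, ∃ m : Fin r, v = Sum.inl m ∧ i ≤ m ∧ m ≤ j := by
  obtain ⟨d, hd⟩ : ∃ d, j.val = i.val + d := ⟨j.val - i.val, by have := Fin.le_def.1 hij; omega⟩
  induction d generalizing i with
  | zero =>
    obtain rfl : i = j := Fin.ext hd.symm
    exact ⟨.nil, by simp, by simp⟩
  | succ d ih =>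
    have hi : i.val + 1 < r := by have := j.isLt; omega
    obtain ⟨p, hp, hs⟩ := ih (i := ⟨i.val + 1, hi⟩) (by rw [Fin.le_def]; simp; omega)
      (by simp; omega)
    have hadj : (corona (SimpleGraph.pathGraph r) G).Adj (Sum.inl i)
        (Sum.inl ⟨i.val + 1, hi⟩) := by
      simp [SimpleGraph.pathGraph_adj]
    refine ⟨.cons hadj p, ?_, ?_⟩
    · rw [SimpleGraph.Walk.length_cons, hp]
      simp
      omega
    · intro v hv
      rw [SimpleGraph.Walk.support_cons, List.mem_cons] at hv
      rcases hv with rfl | hv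
      · exact ⟨i, rfl, le_rfl, hij⟩
      · obtain ⟨m, rfl, h₁, h₂⟩ := hs v hv
        exact ⟨m, rfl, by rw [Fin.le_def] at h₁ ⊢; simp at h₁; omega, h₂⟩

variable {S : Finset (Fin r ⊕ (Fin r × W))} {k : ℕ}

lemma IsKDistMutualVisSet.card_toLeft_le
    (hS : IsKDistMutualVisSet (corona (SimpleGraph.pathGraph r) G) k ↑S) :
    S.toLeft.card ≤ 2 := by
  have key : ∀ a ∈ S.toLeft, ∀ b ∈ S.toLeft, ∀ c ∈ S.toLeft, a < b → b < c → False := by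
    intro a ha b hb c hc hab hbc
    rw [Finset.mem_toLeft] at ha hb hc
    obtain ⟨p, -, -, -, hs⟩ := hS ha hc
    rcases hs _ (inl_mem_support_of_lt_of_lt p hab hbc) hb with h | h
    · exact hab.ne' (Sum.inl_injective h)
    · exact hbc.ne (Sum.inl_injective h)
  by_contra! h
  obtain ⟨a, ha, b, hb, c, hc, hab, hac, hbc⟩ := Finset.two_lt_card.1 h
  rcases lt_or_gt_of_ne hab with h₁ | h₁ <;> rcases lt_or_gt_of_ne hac with h₂ | h₂ <;>
    rcases lt_or_gt_of_ne hbc with h₃ | h₃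
  · exact key a ha b hb c hc h₁ h₃
  · exact key a ha c hc b hb h₂ h₃
  · exact absurd (h₁.trans h₃) h₂.not_gt
  · exact key c hc a ha b hb h₂ h₁
  · exact key b hb a ha c hc h₁ h₂
  · exact absurd (h₃.trans h₁) h₂.not_gt
  · exact key b hb c hc a ha h₃ h₂
  · exact key c hc b hb a ha h₃ h₁

lemma IsKDistMutualVisSet.card_toRight_le [Fintype W] (hk : 2 ≤ k)
    (hS : IsKDistMutualVisSet (corona (SimpleGraph.pathGraph r) G) k ↑S) :
    S.toRight.card ≤ (k - 1) * Fintype.card W := by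
  classical
  have key : ∀ p ∈ S.toRight, ∀ q ∈ S.toRight, q.1.val + 2 ≤ p.1.val + k := by
    intro p hp q hq
    rw [Finset.mem_toRight] at hp hq
    obtain ⟨w, -, -, hw, -⟩ := hS hp hq
    by_cases hpq : q.1.val ≤ p.1.val
    · omega
    · have := w.sub_le_length (coronaHeight_sub_le p.1.val)
      simp only [coronaHeight, le_refl, if_true, if_neg hpq] at this
      omega
  have hcol : ((S.toRight.image Prod.fst).map Fin.valEmbedding).card ≤ k - 1 := by
    rcases (S.toRight.image Prod.fst).eq_empty_or_nonempty with he | hne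
    · simp [he]
    · obtain ⟨p, hp, hpm⟩ := Finset.mem_image.1 ((S.toRight.image Prod.fst).min'_mem hne)
      have hsub : (S.toRight.image Prod.fst).map Fin.valEmbedding ⊆
          Finset.Ico p.1.val (p.1.val + (k - 1)) := by
        intro m hm
        obtain ⟨c, hc, rfl⟩ := Finset.mem_map.1 hm
        have hle : p.1 ≤ c := hpm ▸ Finset.min'_le _ _ hc
        obtain ⟨q, hq, rfl⟩ := Finset.mem_image.1 hc
        have := key p hp q hq
        rw [Fin.le_def] at hle
        simp only [Fin.valEmbedding_apply, Finset.mem_Ico]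
        omega
      simpa using Finset.card_le_card hsub
  have hsub : S.toRight ⊆ S.toRight.image Prod.fst ×ˢ Finset.univ := by
    intro q hq
    simpa using ⟨q.2, Finset.mem_toRight.1 hq⟩
  calc S.toRight.card ≤ _ := Finset.card_le_card hsub
    _ = (S.toRight.image Prod.fst).card * Fintype.card W := by
      rw [Finset.card_product, Finset.card_univ]
    _ ≤ _ := Nat.mul_le_mul_right _ (by simpa only [Finset.card_map] using hcol)

/-- In `P_r ⊙ G`, the end vertices of a subpath of length `k` together with all copies of `G` over
its internal vertices form a `k`-distance mutual-visibility set. -/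
lemma isKDistMutualVisSet_corona_pathGraph [Fintype W] (hk : 2 ≤ k) {a b : Fin r}
    (hab : b.val = a.val + k) :
    IsKDistMutualVisSet (corona (SimpleGraph.pathGraph r) G) k
      ↑(({a, b} : Finset (Fin r)).disjSum (Finset.Ioo a b ×ˢ (Finset.univ : Finset W))) := by
  set T := ({a, b} : Finset (Fin r)).disjSum (Finset.Ioo a b ×ˢ (Finset.univ : Finset W)) with hT
  have hl : ∀ m : Fin r, Sum.inl m ∈ (T : Set (Fin r ⊕ (Fin r × W))) ↔ m = a ∨ m = b := by
    simp [hT]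
  have hr : ∀ q : Fin r × W, Sum.inr q ∈ (T : Set (Fin r ⊕ (Fin r × W))) ↔
      a.val < q.1.val ∧ q.1.val < b.val := by
    simp [hT]
  have refl : ∀ x, SKVisible (corona (SimpleGraph.pathGraph r) G) ↑T k x x := fun x =>
    ⟨.nil, by simp, by simp, by simp, by simp⟩
  have ends : SKVisible (corona (SimpleGraph.pathGraph r) G) ↑T k (Sum.inl a) (Sum.inl b) := by
    obtain ⟨p, hp, hs⟩ := exists_walk_inl_inl (G := G) (i := a) (j := b)
      (by rw [Fin.le_def]; omega)
    refine .of_walk p (coronaHeight_sub_le 0) ?_ (by omega) ?_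
    · simp only [coronaHeight]
      omega
    · intro v hv hvT
      obtain ⟨m, rfl, -, -⟩ := hs v hv
      simpa using (hl m).1 hvT
  have left : ∀ q : Fin r × W, Sum.inr q ∈ (T : Set (Fin r ⊕ (Fin r × W))) →
      SKVisible (corona (SimpleGraph.pathGraph r) G) ↑T k (Sum.inl a) (Sum.inr q) := by
    intro q hq
    have hq' := (hr q).1 hq
    obtain ⟨p, hp, hs⟩ := exists_walk_inl_inl (G := G) (i := a) (j := q.1)
      (by rw [Fin.le_def]; omega)
    refine .of_walk (p.concat (w := Sum.inr q) (by simp)) (coronaHeight_sub_le a.val) ?_ ?_ ?_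
    · simp only [coronaHeight, SimpleGraph.Walk.length_concat, if_neg (not_le.2 hq'.1), hp]
      omega
    · simp only [SimpleGraph.Walk.length_concat, hp]
      omega
    · intro v hv hvT
      simp only [SimpleGraph.Walk.support_concat, List.mem_append, List.mem_singleton] at hv
      rcases hv with hv | rfl
      · obtain ⟨m, rfl, -, h₂⟩ := hs v hv
        rw [Fin.le_def] at h₂
        rcases (hl m).1 hvT with rfl | rfl
        · exact Or.inl rfl
        · omega
      · exact Or.inr rfl
  have right : ∀ q : Fin r × W, Sum.inr q ∈ (T : Set (Fin r ⊕ (Fin r × W))) →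
      SKVisible (corona (SimpleGraph.pathGraph r) G) ↑T k (Sum.inr q) (Sum.inl b) := by
    intro q hq
    have hq' := (hr q).1 hq
    obtain ⟨p, hp, hs⟩ := exists_walk_inl_inl (G := G) (i := q.1) (j := b)
      (by rw [Fin.le_def]; omega)
    refine .of_walk (.cons (u := Sum.inr q) (by simp) p) (coronaHeight_sub_le q.1.val) ?_ ?_ ?_
    · simp only [coronaHeight, SimpleGraph.Walk.length_cons, le_refl, if_true, hp]
      omega
    · simp only [SimpleGraph.Walk.length_cons, hp]
      omega
    · intro v hv hvT
      rw [SimpleGraph.Walk.support_cons, List.mem_cons] at hv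
      rcases hv with rfl | hv
      · exact Or.inl rfl
      · obtain ⟨m, rfl, h₁, -⟩ := hs v hv
        rw [Fin.le_def] at h₁
        rcases (hl m).1 hvT with rfl | rfl
        · omega
        · exact Or.inr rfl
  have copies : ∀ q q' : Fin r × W, Sum.inr q ∈ (T : Set (Fin r ⊕ (Fin r × W))) →
      Sum.inr q' ∈ (T : Set (Fin r ⊕ (Fin r × W))) → q.1.val < q'.1.val →
      SKVisible (corona (SimpleGraph.pathGraph r) G) ↑T k (Sum.inr q) (Sum.inr q') := by
    intro q q' hq hq' hlt
    have h := (hr q).1 hq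
    have h' := (hr q').1 hq'
    obtain ⟨p, hp, hs⟩ := exists_walk_inl_inl (G := G) (i := q.1) (j := q'.1)
      (by rw [Fin.le_def]; omega)
    refine .of_walk (.cons (u := Sum.inr q) (by simp) (p.concat (w := Sum.inr q') (by simp)))
      (coronaHeight_sub_le q.1.val) ?_ ?_ ?_
    · simp only [coronaHeight, SimpleGraph.Walk.length_cons, SimpleGraph.Walk.length_concat,
        le_refl, if_true, if_neg (not_le.2 hlt), hp]
      omega
    · simp only [SimpleGraph.Walk.length_cons, SimpleGraph.Walk.length_concat, hp]
      omega
    · intro v hv hvT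
      simp only [SimpleGraph.Walk.support_cons, SimpleGraph.Walk.support_concat,
        List.mem_cons, List.mem_append, List.not_mem_nil, or_false] at hv
      rcases hv with rfl | hv | rfl
      · exact Or.inl rfl
      · obtain ⟨m, rfl, h₁, h₂⟩ := hs v hv
        rw [Fin.le_def] at h₁ h₂
        rcases (hl m).1 hvT with rfl | rfl <;> omega
      · exact Or.inr rfl
  have copy : ∀ (i : Fin r) (w w' : W), Sum.inr (i, w) ∈ (T : Set (Fin r ⊕ (Fin r × W))) →
      SKVisible (corona (SimpleGraph.pathGraph r) G) ↑T k (Sum.inr (i, w)) (Sum.inr (i, w')) := by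
    intro i w w' hi
    have hi' := (hr _).1 hi
    by_cases hww : w = w'
    · exact hww ▸ refl _
    by_cases hadj : G.Adj w w'
    · have hA : (corona (SimpleGraph.pathGraph r) G).Adj (Sum.inr (i, w)) (Sum.inr (i, w')) := by
        simpa using hadj
      refine ⟨hA.toWalk, ?_, ?_, ?_, ?_⟩
      · simpa using hww
      · simpa using (SimpleGraph.dist_eq_one_iff_adj.2 hA).symm
      · simp
        omega
      · simp
    · let p : (corona (SimpleGraph.pathGraph r) G).Walk (Sum.inr (i, w)) (Sum.inr (i, w')) :=
        .cons (v := Sum.inl i) (by simp) (.cons (by simp) .nil)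
      have hd : p.length = (corona (SimpleGraph.pathGraph r) G).dist
          (Sum.inr (i, w)) (Sum.inr (i, w')) := by
        have h₁ : p.length = 2 := rfl
        have h₂ := SimpleGraph.dist_le p
        have h₃ := p.reachable.dist_eq_zero_iff.not.2 (by simpa using hww)
        have h₄ := SimpleGraph.dist_eq_one_iff_adj.not.2
          (show ¬ (corona (SimpleGraph.pathGraph r) G).Adj (Sum.inr (i, w)) (Sum.inr (i, w')) by
            simpa using hadj)
        omega
      refine ⟨p, p.isPath_of_length_eq_dist hd, hd, hk, ?_⟩
      intro v hv hvT
      simp only [p, SimpleGraph.Walk.support_cons, SimpleGraph.Walk.support_nil, List.mem_cons,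
        List.not_mem_nil, or_false] at hv
      rcases hv with rfl | rfl | rfl
      · exact Or.inl rfl
      · rcases (hl i).1 hvT with rfl | rfl <;> simp at hi'
      · exact Or.inr rfl
  rintro (x | q) hx (y | q') hy
  · rcases (hl x).1 hx with rfl | rfl <;> rcases (hl y).1 hy with rfl | rfl
    · exact refl _
    · exact ends
    · exact ends.symm
    · exact refl _
  · rcases (hl x).1 hx with rfl | rfl
    · exact left q' hy
    · exact (right q' hy).symm
  · rcases (hl y).1 hy with rfl | rfl
    · exact (left q hx).symm
    · exact right q hx
  · rcases lt_trichotomy q.1.val q'.1.val with h | h | h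
    · exact copies q q' hx hy h
    · obtain ⟨i, w⟩ := q
      obtain ⟨i', w'⟩ := q'
      obtain rfl : i = i' := Fin.ext h
      exact copy i w w' hx
    · exact (copies q' q hy hx h).symm

end CoronaPath

/-- For a finite graph `G` on `n ≥ 2` vertices, `r ≥ 3` and `2 ≤ k ≤ r - 1`,
`μ_k(P_r ⊙ G) = (k-1)n + 2`. -/
theorem stmt11 {W : Type*} [Fintype W] (G : SimpleGraph W) (n : ℕ)
    (hn : Fintype.card W = n) (hn2 : 2 ≤ n) (r k : ℕ) (hr : 3 ≤ r)
    (hk2 : 2 ≤ k) (hkr : k ≤ r - 1) :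
    kdistMu (corona (SimpleGraph.pathGraph r) G) k = (k - 1) * n + 2 := by
  have h_le : ∀ S : Finset (Fin r ⊕ (Fin r × W)),
      IsKDistMutualVisSet (corona (SimpleGraph.pathGraph r) G) k ↑S →
      S.card ≤ (k - 1) * n + 2 := by
    intro S hS
    rw [← S.card_toLeft_add_card_toRight, add_comm, ← hn]
    exact add_le_add (hS.card_toRight_le hk2) hS.card_toLeft_le
  refine IsGreatest.csSup_eq ⟨?_, ?_⟩
  · let a : Fin r := ⟨0, by omega⟩
    let b : Fin r := ⟨k, by omega⟩
    have hab : a ≠ b := by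
      simp only [a, b, ne_eq, Fin.mk.injEq]
      omega
    refine ⟨_, isKDistMutualVisSet_corona_pathGraph (a := a) (b := b) hk2 (by simp [a, b]), ?_⟩
    rw [Finset.card_disjSum, Finset.card_product, Finset.card_pair hab, Fin.card_Ioo,
      Finset.card_univ, hn, add_comm]
    simp [a, b]
  · rintro m ⟨S, hS, rfl⟩
    exact h_le S hS
end
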